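/- arXiv:1311.0396 — 11 statements merged into one kernel-verified Lean document; each statement's English description precedes it below -/
import Mathlib

section
/- (Theorem 4.1, constrained case.) Let Ω ⊆ ℝⁿ be open, let U ⊆ (−β,β)ᵐ, and let ν⁰ : ℝⁿ → ℝᵐ be continuous with φ(ν⁰(x)) ∈ U for all x ∈ Ω. Assume: (E1) for every x₀ ∈ Ω and u₀ ∈ U there exist ε > 0, a continuous control u : [0,ε) → U with u(0) = u₀, and a trajectory x : [0,ε) → Ω with control u and x(0) = x₀; and (E2) for every x ∈ Ω the linear span of {u − φ(ν⁰(x)) : u ∈ U} is all of ℝᵐ. Let V : ℝⁿ → ℝ be continuously differentiable and v : Ω → ℝᵐ continuous. Then (V, v) satisfies the constrained off-policy integral equation for every continuous control u : I → U and every trajectory x : I → Ω with control u, if and only if V satisfies the constrained Lyapunov function equation with policy ν⁰ on Ω and v(x) = −(1/2)R⁻¹g(x)ᵀ∇V(x) for all x ∈ Ω. -/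
open Matrix Set

/-- The gradient vector of a scalar function on `Fin n → ℝ`,
whose `j`-th component is the partial derivative in direction `j`. -/
noncomputable def gradVec {n : ℕ} (V : (Fin n → ℝ) → ℝ) (x : Fin n → ℝ) : Fin n → ℝ :=
  fun j => fderiv ℝ V x (Pi.single j 1)

/-- Componentwise application of the saturation function `φ`. -/
def phiVec {m : ℕ} (φ : ℝ → ℝ) (ν : Fin m → ℝ) : Fin m → ℝ := fun l => φ (ν l)

/-- The nonquadratic input penalty `W(v) = 2 ∑ l, r l ∫₀^{v l} ψ(μ) dμ`. -/
noncomputable def Wpen {m : ℕ} (r : Fin m → ℝ) (ψ : ℝ → ℝ) (v : Fin m → ℝ) : ℝ :=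
  2 * ∑ l, r l * ∫ μ in (0:ℝ)..(v l), ψ μ

theorem aux_fderiv_eq {n : ℕ} (V : (Fin n → ℝ) → ℝ) (x w : Fin n → ℝ) :
    fderiv ℝ V x w = gradVec V x ⬝ᵥ w := by
  conv_lhs => rw [pi_eq_sum_univ' w]
  rw [map_sum]
  simp only [dotProduct, gradVec, map_smul, smul_eq_mul]
  refine Finset.sum_congr rfl fun j _ => ?_
  rw [mul_comm]

theorem aux_prim_cont (β : ℝ) (φ ψ : ℝ → ℝ) (hφc : Continuous φ) (hφmono : StrictMono φ)
    (hφodd : ∀ s : ℝ, φ (-s) = -φ s) (hφrange : Set.range φ = Ioo (-β) β)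
    (hψ : ∀ s : ℝ, ψ (φ s) = s) :
    Continuous (fun s => ∫ μ in (0:ℝ)..(φ s), ψ μ) := by
  have h0 : φ 0 = 0 := by
    have := hφodd 0
    simp only [neg_zero] at this
    linarith
  have hmono : MonotoneOn ψ (Ioo (-β) β) := by
    intro a ha b hb hab
    rw [← hφrange] at ha hb
    obtain ⟨s, rfl⟩ := ha
    obtain ⟨t, rfl⟩ := hb
    rw [hψ, hψ]
    exact hφmono.le_iff_le.1 hab
  rw [continuous_iff_continuousAt]
  intro s
  set M := |s| + 1 with hM
  have hMpos : 0 < M := by positivity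
  have hle : φ (-M) ≤ φ M := hφmono.monotone (by linarith)
  have hsub : uIcc (φ (-M)) (φ M) ⊆ Ioo (-β) β := by
    rw [uIcc_of_le hle]
    have h1 : φ (-M) ∈ Ioo (-β) β := hφrange ▸ mem_range_self _
    have h2 : φ M ∈ Ioo (-β) β := hφrange ▸ mem_range_self _
    exact fun y hy => ⟨h1.1.trans_le hy.1, hy.2.trans_lt h2.2⟩
  have hint : IntervalIntegrable ψ MeasureTheory.volume (φ (-M)) (φ M) :=
    (hmono.mono hsub).intervalIntegrable
  have hc := intervalIntegral.continuousOn_primitive_interval' hint (a := 0) (by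
    rw [uIcc_of_le hle]
    constructor
    · rw [← h0]; exact hφmono.monotone (by linarith)
    · conv_lhs => rw [← h0]
      exact hφmono.monotone (by linarith))
  have hs := abs_lt.1 (show |s| < M by linarith)
  have hn : uIcc (φ (-M)) (φ M) ∈ nhds (φ s) := by
    rw [uIcc_of_le hle]
    exact Icc_mem_nhds (hφmono hs.1) (hφmono hs.2)
  exact ContinuousAt.comp (f := φ) (g := fun y => ∫ μ in (0:ℝ)..y, ψ μ)
    (hc.continuousAt hn) hφc.continuousAt

/-- **Theorem 4.1 (constrained case).** For the control-affine system
`ẋ = f(x) + g(x)u` with input saturation `φ`, the pair `(V, v)` satisfies the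
constrained off-policy integral equation for every continuous control taking values in
`U` and every trajectory staying in `Ω`, if and only if `V` satisfies the constrained
Lyapunov function equation with policy `ν⁰` on `Ω` and `v = -(1/2) R⁻¹ gᵀ ∇V` on `Ω`. -/
theorem data_based_api_constrained_iff {n m : ℕ}
    (f : (Fin n → ℝ) → (Fin n → ℝ)) (g : (Fin n → ℝ) → Matrix (Fin n) (Fin m) ℝ)
    (hf : Continuous f) (hg : Continuous g)
    (Q : (Fin n → ℝ) → ℝ) (hQ : Continuous Q)
    (β : ℝ) (hβ : 0 < β)
    (φ ψ : ℝ → ℝ) (hφc : Continuous φ) (hφmono : StrictMono φ)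
    (hφodd : ∀ s : ℝ, φ (-s) = -φ s) (hφrange : Set.range φ = Ioo (-β) β)
    (hψ : ∀ s : ℝ, ψ (φ s) = s)
    (r : Fin m → ℝ) (hr : ∀ l, 0 < r l)
    (R : Matrix (Fin m) (Fin m) ℝ) (hR : R = Matrix.diagonal r)
    (Ω : Set (Fin n → ℝ)) (hΩ : IsOpen Ω)
    (U : Set (Fin m → ℝ)) (hU : ∀ u ∈ U, ∀ l, u l ∈ Ioo (-β) β)
    (ν₀ : (Fin n → ℝ) → (Fin m → ℝ)) (hν₀ : Continuous ν₀)
    (hν₀U : ∀ x ∈ Ω, phiVec φ (ν₀ x) ∈ U)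
    -- (E1): local existence of trajectories with any initial state in Ω and
    -- any initial control value in U
    (hE1 : ∀ x₀ ∈ Ω, ∀ u₀ ∈ U, ∃ ε > (0:ℝ), ∃ u : ℝ → (Fin m → ℝ), ∃ x : ℝ → (Fin n → ℝ),
      ContinuousOn u (Ico 0 ε) ∧ u 0 = u₀ ∧ (∀ t ∈ Ico (0:ℝ) ε, u t ∈ U) ∧
      x 0 = x₀ ∧ (∀ t ∈ Ico (0:ℝ) ε, x t ∈ Ω) ∧
      (∀ t ∈ Ico (0:ℝ) ε, HasDerivWithinAt x (f (x t) + g (x t) *ᵥ u t) (Ico 0 ε) t))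
    -- (E2): richness of the control set
    (hE2 : ∀ x ∈ Ω,
      Submodule.span ℝ {d : Fin m → ℝ | ∃ u ∈ U, d = u - phiVec φ (ν₀ x)} = ⊤)
    (V : (Fin n → ℝ) → ℝ) (hV : ContDiff ℝ 1 V)
    (v : (Fin n → ℝ) → (Fin m → ℝ)) (hv : ContinuousOn v Ω) :
    (∀ I : Set ℝ, I.OrdConnected →
      ∀ (u : ℝ → Fin m → ℝ) (x : ℝ → Fin n → ℝ),
        ContinuousOn u I → (∀ t ∈ I, u t ∈ U) → (∀ t ∈ I, x t ∈ Ω) →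
        (∀ t ∈ I, HasDerivWithinAt x (f (x t) + g (x t) *ᵥ u t) I t) →
        ∀ t ∈ I, ∀ Δt ≥ (0:ℝ), t + Δt ∈ I →
          V (x t) - V (x (t + Δt))
              + 2 * ∫ τ in t..(t + Δt), v (x τ) ⬝ᵥ R *ᵥ (phiVec φ (ν₀ (x τ)) - u τ)
            = ∫ τ in t..(t + Δt), (Q (x τ) + Wpen r ψ (phiVec φ (ν₀ (x τ)))))
    ↔ ((∀ x ∈ Ω, gradVec V x ⬝ᵥ (f x + g x *ᵥ phiVec φ (ν₀ x)) + Q x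
            + Wpen r ψ (phiVec φ (ν₀ x)) = 0) ∧
        (∀ x ∈ Ω, v x = (-(1/2) : ℝ) • (R⁻¹ *ᵥ ((g x)ᵀ *ᵥ gradVec V x)))) := by
  have hW : Continuous (fun x => Wpen r ψ (phiVec φ (ν₀ x))) := by
    have hp := aux_prim_cont β φ ψ hφc hφmono hφodd hφrange hψ
    unfold Wpen phiVec
    refine continuous_const.mul (continuous_finsetSum _ fun l _ => continuous_const.mul ?_)
    exact hp.comp ((continuous_apply l).comp hν₀)
  have hphi : Continuous (fun x => phiVec φ (ν₀ x)) := by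
    unfold phiVec
    exact continuous_pi fun l => hφc.comp ((continuous_apply l).comp hν₀)
  have hRdet : IsUnit R.det := by
    rw [hR, Matrix.det_diagonal]
    exact (Finset.prod_pos fun l _ => hr l).ne'.isUnit
  have hRt : Rᵀ = R := by rw [hR, Matrix.diagonal_transpose]
  -- pointwise form
  have key : (∀ x ∈ Ω, ∀ u ∈ U, gradVec V x ⬝ᵥ (f x + g x *ᵥ u)
        = 2 * (v x ⬝ᵥ R *ᵥ (phiVec φ (ν₀ x) - u)) - (Q x + Wpen r ψ (phiVec φ (ν₀ x))))
      ↔ ((∀ x ∈ Ω, gradVec V x ⬝ᵥ (f x + g x *ᵥ phiVec φ (ν₀ x)) + Q x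
            + Wpen r ψ (phiVec φ (ν₀ x)) = 0) ∧
        (∀ x ∈ Ω, v x = (-(1/2) : ℝ) • (R⁻¹ *ᵥ ((g x)ᵀ *ᵥ gradVec V x)))) := by
    have hvR : ∀ x d, v x ⬝ᵥ R *ᵥ d = (R *ᵥ v x) ⬝ᵥ d := by
      intro x d
      rw [dotProduct_mulVec, ← mulVec_transpose, hRt]
    have hgV : ∀ x d, gradVec V x ⬝ᵥ g x *ᵥ d = ((g x)ᵀ *ᵥ gradVec V x) ⬝ᵥ d := by
      intro x d
      rw [dotProduct_mulVec, ← mulVec_transpose]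
    constructor
    · intro h
      have hL : ∀ x ∈ Ω, gradVec V x ⬝ᵥ (f x + g x *ᵥ phiVec φ (ν₀ x)) + Q x
            + Wpen r ψ (phiVec φ (ν₀ x)) = 0 := by
        intro x hx
        have := h x hx _ (hν₀U x hx)
        simp only [sub_self, mulVec_zero, dotProduct_zero] at this
        linarith
      refine ⟨hL, fun x hx => ?_⟩
      set a := (g x)ᵀ *ᵥ gradVec V x + (2:ℝ) • (R *ᵥ v x) with ha
      have hd : ∀ d : Fin m → ℝ, a ⬝ᵥ d = 0 := by
        intro d
        have hmem : d ∈ Submodule.span ℝ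
            {d : Fin m → ℝ | ∃ u ∈ U, d = u - phiVec φ (ν₀ x)} := by
          rw [hE2 x hx]; trivial
        induction hmem using Submodule.span_induction with
        | mem d hd =>
          obtain ⟨u, hu, rfl⟩ := hd
          have h1 := h x hx u hu
          have h2 := hL x hx
          rw [hvR] at h1
          rw [dotProduct_add, hgV] at h1 h2
          rw [ha, add_dotProduct, smul_dotProduct, smul_eq_mul]
          simp only [dotProduct_sub] at h1 ⊢
          linarith
        | zero => simp
        | add p q _ _ hp hq => rw [dotProduct_add, hp, hq, add_zero]
        | smul c p _ hp => rw [dotProduct_smul, hp, smul_zero]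
      have ha0 : a = 0 := dotProduct_self_eq_zero.1 (hd a)
      have h3 : (g x)ᵀ *ᵥ gradVec V x = -((2:ℝ) • (R *ᵥ v x)) := eq_neg_of_add_eq_zero_left ha0
      rw [h3, mulVec_neg, mulVec_smul, mulVec_mulVec, Matrix.nonsing_inv_mul _ hRdet, one_mulVec,
        smul_neg, smul_smul]
      norm_num
    · rintro ⟨hL, hvx⟩ x hx u hu
      have h2 := hL x hx
      have h3 : R *ᵥ v x = (-(1/2) : ℝ) • ((g x)ᵀ *ᵥ gradVec V x) := by
        rw [hvx x hx, mulVec_smul, mulVec_mulVec, Matrix.mul_nonsing_inv _ hRdet, one_mulVec]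
      rw [hvR, h3, smul_dotProduct, smul_eq_mul, dotProduct_sub, dotProduct_add, hgV]
      rw [dotProduct_add, hgV] at h2
      linarith
  -- continuity of the integrands along trajectories
  have hxc : ∀ (I : Set ℝ) (u : ℝ → Fin m → ℝ) (x : ℝ → Fin n → ℝ),
      (∀ t ∈ I, HasDerivWithinAt x (f (x t) + g (x t) *ᵥ u t) I t) → ContinuousOn x I :=
    fun I u x h t ht => (h t ht).continuousWithinAt
  have hc1 : ∀ (I : Set ℝ) (u : ℝ → Fin m → ℝ) (x : ℝ → Fin n → ℝ),
      ContinuousOn u I → (∀ t ∈ I, x t ∈ Ω) → ContinuousOn x I →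
      ContinuousOn (fun τ => v (x τ) ⬝ᵥ R *ᵥ (phiVec φ (ν₀ (x τ)) - u τ)) I := by
    intro I u x hu hxΩ hx
    have hvx : ContinuousOn (fun τ => v (x τ)) I := hv.comp hx hxΩ
    have hpx : ContinuousOn (fun τ => phiVec φ (ν₀ (x τ)) - u τ) I :=
      (hphi.comp_continuousOn hx).sub hu
    have hb : Continuous (fun p : (Fin m → ℝ) × (Fin m → ℝ) => p.1 ⬝ᵥ R *ᵥ p.2) :=
      continuous_fst.dotProduct (continuous_const.matrix_mulVec continuous_snd)
    exact hb.comp_continuousOn (hvx.prodMk hpx)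
  have hc2 : ∀ (I : Set ℝ) (x : ℝ → Fin n → ℝ), ContinuousOn x I →
      ContinuousOn (fun τ => Q (x τ) + Wpen r ψ (phiVec φ (ν₀ (x τ)))) I :=
    fun I x hx => (hQ.add hW).comp_continuousOn hx
  have hdV : ∀ (I : Set ℝ) (u : ℝ → Fin m → ℝ) (x : ℝ → Fin n → ℝ) (t : ℝ),
      HasDerivWithinAt x (f (x t) + g (x t) *ᵥ u t) I t →
      HasDerivWithinAt (fun τ => V (x τ)) (gradVec V (x t) ⬝ᵥ (f (x t) + g (x t) *ᵥ u t)) I t := by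
    intro I u x t h
    rw [← aux_fderiv_eq]
    exact ((hV.differentiable one_ne_zero) (x t)).hasFDerivAt.comp_hasDerivWithinAt t h
  rw [← key]
  constructor
  · intro h x₀ hx₀ u₀ hu₀
    obtain ⟨ε, hε, u, x, huc, hu0, huU, hx0, hxΩ, hder⟩ := hE1 x₀ hx₀ u₀ hu₀
    have h0 : (0:ℝ) ∈ Ico 0 ε := ⟨le_rfl, hε⟩
    have hx := hxc _ u x hder
    have e1 := hc1 _ u x huc hxΩ hx
    have e2 := hc2 _ x hx
    set F := fun τ => v (x τ) ⬝ᵥ R *ᵥ (phiVec φ (ν₀ (x τ)) - u τ) with hF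
    set G := fun τ => Q (x τ) + Wpen r ψ (phiVec φ (ν₀ (x τ))) with hG
    have fund : ∀ H : ℝ → ℝ, ContinuousOn H (Ico 0 ε) →
        HasDerivWithinAt (fun t => ∫ τ in (0:ℝ)..t, H τ) (H 0) (Ici 0) 0 := by
      intro H hH
      refine intervalIntegral.integral_hasDerivWithinAt_right (t := Ioi 0) (by simp) ?_ ?_
      · exact ⟨Ico 0 ε, Ico_mem_nhdsGT hε, hH.aestronglyMeasurable measurableSet_Ico⟩
      · exact ((hH 0 h0).mono_of_mem_nhdsWithin (Ico_mem_nhdsGE hε)).mono Ioi_subset_Ici_self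
    have hA : HasDerivWithinAt (fun t => V (x 0) + (2 * (∫ τ in (0:ℝ)..t, F τ)
        - ∫ τ in (0:ℝ)..t, G τ)) (2 * F 0 - G 0) (Ico 0 ε) 0 :=
      ((((fund F e1).const_mul 2).sub (fund G e2)).const_add _).mono Ico_subset_Ici_self
    have hB := hdV _ u x 0 (hder 0 h0)
    have hA' : HasDerivWithinAt (fun τ => V (x τ)) (2 * F 0 - G 0) (Ico 0 ε) 0 := by
      refine hA.congr_of_mem (fun t ht => ?_) h0
      have := h (Ico 0 ε) ordConnected_Ico u x huc huU hxΩ hder 0 h0 t ht.1 (by simpa using ht)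
      rw [zero_add] at this
      linarith
    have huniq : UniqueDiffWithinAt ℝ (Ico 0 ε) 0 := uniqueDiffOn_Ico 0 ε 0 h0
    have := huniq.eq_deriv _ hB hA'
    rw [hx0, hu0] at this
    rw [this, hF, hG]
    simp only [hx0, hu0]
  · intro h I hI u x huc huU hxΩ hder t ht Δ hΔ htΔ
    have hle : t ≤ t + Δ := by linarith
    have hsub : Icc t (t + Δ) ⊆ I := hI.out ht htΔ
    have hx := hxc _ u x hder
    have e1 := ((hc1 _ u x huc hxΩ hx).mono hsub).intervalIntegrable_of_Icc
      (μ := MeasureTheory.volume) hle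
    have e2 := ((hc2 _ x hx).mono hsub).intervalIntegrable_of_Icc
      (μ := MeasureTheory.volume) hle
    have hVd : ∀ s ∈ I, HasDerivWithinAt (fun τ => V (x τ))
        (2 * (v (x s) ⬝ᵥ R *ᵥ (phiVec φ (ν₀ (x s)) - u s))
          - (Q (x s) + Wpen r ψ (phiVec φ (ν₀ (x s))))) I s := by
      intro s hs
      rw [← h (x s) (hxΩ s hs) (u s) (huU s hs)]
      exact hdV _ u x s (hder s hs)
    have hFTC := intervalIntegral.integral_eq_sub_of_hasDerivAt_of_le hle
      (fun s hs => ((hVd s (hsub hs)).continuousWithinAt).mono hsub)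
      (fun s hs => ((hVd s (hsub (Ioo_subset_Icc_self hs))).hasDerivAt
        (Filter.mem_of_superset (Icc_mem_nhds hs.1 hs.2) hsub)))
      ((e1.const_mul 2).sub e2)
    rw [intervalIntegral.integral_sub (e1.const_mul 2) e2,
      intervalIntegral.integral_const_mul] at hFTC
    linarith
end

section
/- (Theorem 5.1, unconstrained case.) Let Ω ⊆ ℝⁿ be open, let U ⊆ ℝᵐ, and let w : ℝⁿ → ℝᵐ be continuous with w(x) ∈ U for all x ∈ Ω. Assume: (E1) for every x₀ ∈ Ω and u₀ ∈ U there exist ε > 0, a continuous control u : [0,ε) → U with u(0) = u₀, and a trajectory x : [0,ε) → Ω with control u and x(0) = x₀; and (E2) for every x ∈ Ω the linear span of {u − w(x) : u ∈ U} is all of ℝᵐ. Let V : ℝⁿ → ℝ be continuously differentiable and v : Ω → ℝᵐ continuous. Then (V, v) satisfies the unconstrained off-policy integral equation for every continuous control u : I → U and every trajectory x : I → Ω with control u, if and only if V satisfies the unconstrained Lyapunov function equation with policy w on Ω and v(x) = −(1/2)R⁻¹g(x)ᵀ∇V(x) for all x ∈ Ω. -/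
open Matrix Set

lemma aux_dot {k : ℕ} {I : Set ℝ} {p q : ℝ → Fin k → ℝ} (hp : ContinuousOn p I)
    (hq : ContinuousOn q I) : ContinuousOn (fun t => p t ⬝ᵥ q t) I := by
  have h : Continuous (fun z : (Fin k → ℝ) × (Fin k → ℝ) => z.1 ⬝ᵥ z.2) :=
    continuous_fst.dotProduct continuous_snd
  exact h.comp_continuousOn (hp.prodMk hq)

lemma aux_mulVec {k l : ℕ} {I : Set ℝ} {p : ℝ → Matrix (Fin k) (Fin l) ℝ} {q : ℝ → Fin l → ℝ}
    (hp : ContinuousOn p I) (hq : ContinuousOn q I) : ContinuousOn (fun t => p t *ᵥ q t) I := by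
  have h : Continuous (fun z : (Matrix (Fin k) (Fin l) ℝ) × (Fin l → ℝ) => z.1 *ᵥ z.2) :=
    continuous_fst.matrix_mulVec continuous_snd
  exact h.comp_continuousOn (hp.prodMk hq)

lemma aux_grad {n : ℕ} (V : (Fin n → ℝ) → ℝ) (x y : Fin n → ℝ) :
    fderiv ℝ V x y = gradVec V x ⬝ᵥ y := by
  conv_lhs => rw [pi_eq_sum_univ' y]
  simp [dotProduct, gradVec, map_sum, mul_comm]

lemma aux_grad_cont {n : ℕ} (V : (Fin n → ℝ) → ℝ) (hV : ContDiff ℝ 1 V) :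
    Continuous (gradVec V) := by
  refine continuous_pi fun j => ?_
  exact (hV.continuous_fderiv (by norm_num)).clm_apply continuous_const

/-- The pointwise residual. -/
noncomputable def residF {n m : ℕ}
    (f : (Fin n → ℝ) → (Fin n → ℝ)) (g : (Fin n → ℝ) → Matrix (Fin n) (Fin m) ℝ)
    (Q : (Fin n → ℝ) → ℝ) (R : Matrix (Fin m) (Fin m) ℝ)
    (w : (Fin n → ℝ) → (Fin m → ℝ)) (V : (Fin n → ℝ) → ℝ)
    (v : (Fin n → ℝ) → (Fin m → ℝ)) (x : Fin n → ℝ) (u : Fin m → ℝ) : ℝ :=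
  gradVec V x ⬝ᵥ (f x + g x *ᵥ u) - 2 * (v x ⬝ᵥ R *ᵥ (w x - u))
    + (Q x + w x ⬝ᵥ R *ᵥ w x)

lemma aux_traj {n m : ℕ}
    (f : (Fin n → ℝ) → (Fin n → ℝ)) (g : (Fin n → ℝ) → Matrix (Fin n) (Fin m) ℝ)
    (hf : Continuous f) (hg : Continuous g)
    (Q : (Fin n → ℝ) → ℝ) (hQ : Continuous Q)
    (R : Matrix (Fin m) (Fin m) ℝ)
    (Ω : Set (Fin n → ℝ))
    (w : (Fin n → ℝ) → (Fin m → ℝ)) (hw : Continuous w)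
    (V : (Fin n → ℝ) → ℝ) (hV : ContDiff ℝ 1 V)
    (v : (Fin n → ℝ) → (Fin m → ℝ)) (hv : ContinuousOn v Ω)
    (I : Set ℝ) (hI : I.OrdConnected)
    (u : ℝ → Fin m → ℝ) (x : ℝ → Fin n → ℝ)
    (hu : ContinuousOn u I) (hxΩ : ∀ t ∈ I, x t ∈ Ω)
    (hx : ∀ t ∈ I, HasDerivWithinAt x (f (x t) + g (x t) *ᵥ u t) I t) :
    ContinuousOn (fun τ => residF f g Q R w V v (x τ) (u τ)) I ∧
    ∀ a ∈ I, ∀ b ∈ I, a ≤ b →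
      ((V (x a) - V (x b) + 2 * ∫ τ in a..b, v (x τ) ⬝ᵥ R *ᵥ (w (x τ) - u τ))
        - ∫ τ in a..b, (Q (x τ) + w (x τ) ⬝ᵥ R *ᵥ w (x τ)))
        = - ∫ τ in a..b, residF f g Q R w V v (x τ) (u τ) := by
  have cx : ContinuousOn x I := fun t ht => (hx t ht).continuousWithinAt
  have cw : ContinuousOn (fun t => w (x t)) I := hw.comp_continuousOn cx
  have cv : ContinuousOn (fun t => v (x t)) I := hv.comp cx hxΩ
  have c1 : ContinuousOn (fun t => gradVec V (x t) ⬝ᵥ (f (x t) + g (x t) *ᵥ u t)) I :=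
    aux_dot ((aux_grad_cont V hV).comp_continuousOn cx)
      ((hf.comp_continuousOn cx).add (aux_mulVec (hg.comp_continuousOn cx) hu))
  have c2 : ContinuousOn (fun t => v (x t) ⬝ᵥ R *ᵥ (w (x t) - u t)) I :=
    aux_dot cv (aux_mulVec continuousOn_const (cw.sub hu))
  have c3 : ContinuousOn (fun t => Q (x t) + w (x t) ⬝ᵥ R *ᵥ w (x t)) I :=
    (hQ.comp_continuousOn cx).add (aux_dot cw (aux_mulVec continuousOn_const cw))
  refine ⟨(c1.sub (continuousOn_const.mul c2)).add c3, ?_⟩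
  intro a ha b hb hab
  have hsub : Icc a b ⊆ I := hI.out ha hb
  have hsub' : uIcc a b ⊆ I := by rwa [uIcc_of_le hab]
  have i1 := (c1.mono hsub').intervalIntegrable (μ := MeasureTheory.volume)
  have i2 := (c2.mono hsub').intervalIntegrable (μ := MeasureTheory.volume)
  have i3 := (c3.mono hsub').intervalIntegrable (μ := MeasureTheory.volume)
  have hF : ∫ τ in a..b, gradVec V (x τ) ⬝ᵥ (f (x τ) + g (x τ) *ᵥ u τ) = V (x b) - V (x a) := by
    refine intervalIntegral.integral_eq_sub_of_hasDeriv_right_of_le (f := fun τ => V (x τ)) hab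
      (hV.continuous.comp_continuousOn (cx.mono hsub)) ?_ i1
    intro t ht
    have h1 : HasDerivAt x (f (x t) + g (x t) *ᵥ u t) t :=
      (hx t (hsub (Ioo_subset_Icc_self ht))).hasDerivAt
        (Filter.mem_of_superset (Icc_mem_nhds ht.1 ht.2) hsub)
    have h2 := ((hV.differentiable (by norm_num)) (x t)).hasFDerivAt.comp_hasDerivAt t h1
    rw [aux_grad] at h2
    exact h2.hasDerivWithinAt
  unfold residF
  rw [intervalIntegral.integral_add (i1.sub (i2.const_mul 2)) i3,
    intervalIntegral.integral_sub i1 (i2.const_mul 2), hF, intervalIntegral.integral_const_mul]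
  ring

lemma aux_zero {φ : ℝ → ℝ} {ε : ℝ} (hε : 0 < ε) (hc : ContinuousOn φ (Ico 0 ε))
    (h : ∀ b ∈ Ico 0 ε, ∫ τ in (0:ℝ)..b, φ τ = 0) : φ 0 = 0 := by
  have h0 : (0:ℝ) ∈ Ico 0 ε := ⟨le_rfl, hε⟩
  have hm : Ico 0 ε ∈ nhdsWithin (0:ℝ) (Ici 0) := Ico_mem_nhdsGE hε
  have hm' : Ioo 0 ε ∈ nhdsWithin (0:ℝ) (Ioi 0) := Ioo_mem_nhdsGT hε
  have d1 : HasDerivWithinAt (fun b => ∫ τ in (0:ℝ)..b, φ τ) (φ 0) (Ici 0) 0 := by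
    refine intervalIntegral.integral_hasDerivWithinAt_right (t := Ioi 0) (by simp) ?_ ?_
    · exact ⟨Ioo 0 ε, hm', (hc.mono Ioo_subset_Ico_self).aestronglyMeasurable measurableSet_Ioo⟩
    · exact (hc 0 h0).mono_of_mem_nhdsWithin
        (Filter.mem_of_superset hm' Ioo_subset_Ico_self)
  have d2 : HasDerivWithinAt (fun b => ∫ τ in (0:ℝ)..b, φ τ) 0 (Ici 0) 0 := by
    refine (hasDerivWithinAt_const (0:ℝ) (Ici 0) (0:ℝ)).congr_of_eventuallyEq ?_ (by simp)
    filter_upwards [hm] with b hb using h b hb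
  exact (uniqueDiffWithinAt_Ici (0:ℝ)).eq_deriv _ d1 d2

lemma aux_alg {n m : ℕ} (p : Fin n → ℝ) (F : Fin n → ℝ) (G : Matrix (Fin n) (Fin m) ℝ)
    (R : Matrix (Fin m) (Fin m) ℝ) (hR : R.IsSymm) (y w u : Fin m → ℝ) :
    p ⬝ᵥ (F + G *ᵥ u) - 2 * (y ⬝ᵥ R *ᵥ (w - u))
      = p ⬝ᵥ (F + G *ᵥ w) + (Gᵀ *ᵥ p + (2:ℝ) • (R *ᵥ y)) ⬝ᵥ (u - w) := by
  have e1 : ∀ z, p ⬝ᵥ G *ᵥ z = (Gᵀ *ᵥ p) ⬝ᵥ z := fun z => by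
    rw [dotProduct_mulVec, mulVec_transpose]
  have e2 : ∀ z, y ⬝ᵥ R *ᵥ z = (R *ᵥ y) ⬝ᵥ z := fun z => by
    rw [dotProduct_mulVec, ← mulVec_transpose, hR.eq]
  simp only [dotProduct_add, e1, e2, dotProduct_sub, add_dotProduct, smul_dotProduct, smul_eq_mul]
  ring

/-- **Theorem 5.1 (unconstrained case).** For the control-affine system
`ẋ = f(x) + g(x)u`, the pair `(V, v)` satisfies the unconstrained off-policy integral
equation for every continuous control taking values in `U` and every trajectory staying
in `Ω`, if and only if `V` satisfies the unconstrained Lyapunov function equation with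
policy `w` on `Ω` and `v = -(1/2) R⁻¹ gᵀ ∇V` on `Ω`. -/
theorem data_based_api_unconstrained_iff {n m : ℕ}
    (f : (Fin n → ℝ) → (Fin n → ℝ)) (g : (Fin n → ℝ) → Matrix (Fin n) (Fin m) ℝ)
    (hf : Continuous f) (hg : Continuous g)
    (Q : (Fin n → ℝ) → ℝ) (hQ : Continuous Q)
    (R : Matrix (Fin m) (Fin m) ℝ) (hRsymm : R.IsSymm) (hRpos : R.PosDef)
    (Ω : Set (Fin n → ℝ)) (hΩ : IsOpen Ω)
    (U : Set (Fin m → ℝ))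
    (w : (Fin n → ℝ) → (Fin m → ℝ)) (hw : Continuous w) (hwU : ∀ x ∈ Ω, w x ∈ U)
    -- (E1): local existence of trajectories with any initial state in Ω and
    -- any initial control value in U
    (hE1 : ∀ x₀ ∈ Ω, ∀ u₀ ∈ U, ∃ ε > (0:ℝ), ∃ u : ℝ → (Fin m → ℝ), ∃ x : ℝ → (Fin n → ℝ),
      ContinuousOn u (Ico 0 ε) ∧ u 0 = u₀ ∧ (∀ t ∈ Ico (0:ℝ) ε, u t ∈ U) ∧
      x 0 = x₀ ∧ (∀ t ∈ Ico (0:ℝ) ε, x t ∈ Ω) ∧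
      (∀ t ∈ Ico (0:ℝ) ε, HasDerivWithinAt x (f (x t) + g (x t) *ᵥ u t) (Ico 0 ε) t))
    -- (E2): richness of the control set
    (hE2 : ∀ x ∈ Ω, Submodule.span ℝ {d : Fin m → ℝ | ∃ u ∈ U, d = u - w x} = ⊤)
    (V : (Fin n → ℝ) → ℝ) (hV : ContDiff ℝ 1 V)
    (v : (Fin n → ℝ) → (Fin m → ℝ)) (hv : ContinuousOn v Ω) :
    (∀ I : Set ℝ, I.OrdConnected →
      ∀ (u : ℝ → Fin m → ℝ) (x : ℝ → Fin n → ℝ),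
        ContinuousOn u I → (∀ t ∈ I, u t ∈ U) → (∀ t ∈ I, x t ∈ Ω) →
        (∀ t ∈ I, HasDerivWithinAt x (f (x t) + g (x t) *ᵥ u t) I t) →
        ∀ t ∈ I, ∀ Δt ≥ (0:ℝ), t + Δt ∈ I →
          V (x t) - V (x (t + Δt))
              + 2 * ∫ τ in t..(t + Δt), v (x τ) ⬝ᵥ R *ᵥ (w (x τ) - u τ)
            = ∫ τ in t..(t + Δt), (Q (x τ) + w (x τ) ⬝ᵥ R *ᵥ w (x τ)))
    ↔ ((∀ x ∈ Ω, gradVec V x ⬝ᵥ (f x + g x *ᵥ w x) + Q x + w x ⬝ᵥ R *ᵥ w x = 0) ∧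
        (∀ x ∈ Ω, v x = (-(1/2) : ℝ) • (R⁻¹ *ᵥ ((g x)ᵀ *ᵥ gradVec V x)))) := by
  have hdet : IsUnit R.det := hRpos.det_pos.ne'.isUnit
  have hvR : ∀ x, (v x = (-(1/2) : ℝ) • (R⁻¹ *ᵥ ((g x)ᵀ *ᵥ gradVec V x))) ↔
      (g x)ᵀ *ᵥ gradVec V x + (2:ℝ) • (R *ᵥ v x) = 0 := by
    intro x
    constructor
    · intro h
      rw [h, mulVec_smul, mulVec_mulVec, Matrix.mul_nonsing_inv _ hdet, one_mulVec, smul_smul]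
      norm_num
    · intro h
      rw [eq_neg_of_add_eq_zero_left h, mulVec_neg, mulVec_smul, mulVec_mulVec,
        Matrix.nonsing_inv_mul _ hdet, one_mulVec, smul_neg, smul_smul]
      norm_num
  constructor
  · intro H
    have key : ∀ x ∈ Ω, ∀ u ∈ U, residF f g Q R w V v x u = 0 := by
      intro x₀ hx₀ u₀ hu₀
      obtain ⟨ε, hε, u, x, cu, hu0, huU, hx0, hxΩ, hx⟩ := hE1 x₀ hx₀ u₀ hu₀
      obtain ⟨c, hc⟩ := aux_traj f g hf hg Q hQ R Ω w hw V hV v hv (Ico 0 ε) ordConnected_Ico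
        u x cu hxΩ hx
      have h0 : (0:ℝ) ∈ Ico 0 ε := ⟨le_rfl, hε⟩
      have := aux_zero hε c (by
        intro b hb
        have h1 := hc 0 h0 b hb hb.1
        have h2 := H (Ico 0 ε) ordConnected_Ico u x cu huU hxΩ hx 0 h0 b hb.1 (by simpa using hb)
        rw [zero_add] at h2
        linarith)
      simpa [hx0, hu0] using this
    have lfe : ∀ x ∈ Ω, gradVec V x ⬝ᵥ (f x + g x *ᵥ w x) + Q x + w x ⬝ᵥ R *ᵥ w x = 0 := by
      intro x hx
      have := key x hx (w x) (hwU x hx)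
      simp only [residF, sub_self, mulVec_zero, dotProduct_zero, mul_zero, sub_zero] at this
      linarith
    refine ⟨lfe, fun x hx => (hvR x).2 ?_⟩
    set q := (g x)ᵀ *ᵥ gradVec V x + (2:ℝ) • (R *ᵥ v x) with hq
    have hd : ∀ d ∈ Submodule.span ℝ {d : Fin m → ℝ | ∃ u ∈ U, d = u - w x}, q ⬝ᵥ d = 0 := by
      intro d hd
      induction hd using Submodule.span_induction with
      | mem d hd =>
        obtain ⟨u, hu, rfl⟩ := hd
        have h1 := key x hx u hu
        rw [residF, aux_alg _ _ _ _ hRsymm, ← hq] at h1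
        linarith [lfe x hx]
      | zero => simp
      | add a b _ _ ha hb => rw [dotProduct_add, ha, hb, add_zero]
      | smul c a _ ha => rw [dotProduct_smul, ha, smul_zero]
    rw [hE2 x hx] at hd
    exact dotProduct_self_eq_zero.1 (hd q trivial)
  · rintro ⟨lfe, hvv⟩ I hI u x cu huU hxΩ hx t ht Δt hΔ htΔ
    obtain ⟨c, hc⟩ := aux_traj f g hf hg Q hQ R Ω w hw V hV v hv I hI u x cu hxΩ hx
    have h1 := hc t ht (t + Δt) htΔ (by linarith)
    have h2 : ∫ τ in t..(t + Δt), residF f g Q R w V v (x τ) (u τ) = 0 := by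
      rw [intervalIntegral.integral_congr (g := fun _ => (0:ℝ))]
      · simp
      · intro τ hτ
        rw [uIcc_of_le (by linarith)] at hτ
        have hτΩ := hxΩ τ (hI.out ht htΔ hτ)
        simp only [residF]
        rw [aux_alg _ _ _ _ hRsymm, (hvR _).1 (hvv _ hτΩ), zero_dotProduct]
        linarith [lfe _ hτΩ]
    linarith
end

section
/- (Forward direction of Theorem 4.1; equation (4.3).) Let Ω ⊆ ℝⁿ be open, let ν⁰ : ℝⁿ → ℝᵐ be continuous, and let V : ℝⁿ → ℝ be continuously differentiable, satisfying the constrained Lyapunov function equation with policy ν⁰ on Ω. Define v(x) = −(1/2)R⁻¹g(x)ᵀ∇V(x). Then for every continuous control u : I → ℝᵐ and every trajectory x : I → Ω with control u, the pair (V, v) satisfies the constrained off-policy integral equation, i.e., for all t, t+Δt ∈ I with Δt ≥ 0: V(x(t)) − V(x(t+Δt)) + 2∫_t^{t+Δt} v(x(τ))ᵀR(φ(ν⁰(x(τ))) − u(τ)) dτ = ∫_t^{t+Δt} (Q(x(τ)) + W(φ(ν⁰(x(τ))))) dτ. -/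
open Matrix Set

/-- **Forward direction of Theorem 4.1 (equation (4.3)).** If `V` solves the constrained
Lyapunov function equation with policy `ν⁰` on `Ω` and `v = -(1/2) R⁻¹ gᵀ ∇V`, then
`(V, v)` satisfies the constrained off-policy integral equation along every trajectory
in `Ω` generated by any continuous control. -/
theorem constrained_lfe_implies_integral_equation {n m : ℕ}
    (f : (Fin n → ℝ) → (Fin n → ℝ)) (g : (Fin n → ℝ) → Matrix (Fin n) (Fin m) ℝ)
    (hf : Continuous f) (hg : Continuous g)
    (Q : (Fin n → ℝ) → ℝ) (hQ : Continuous Q)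
    (β : ℝ) (hβ : 0 < β)
    (φ ψ : ℝ → ℝ) (hφc : Continuous φ) (hφmono : StrictMono φ)
    (hφodd : ∀ s : ℝ, φ (-s) = -φ s) (hφrange : Set.range φ = Ioo (-β) β)
    (hψ : ∀ s : ℝ, ψ (φ s) = s)
    (r : Fin m → ℝ) (hr : ∀ l, 0 < r l)
    (R : Matrix (Fin m) (Fin m) ℝ) (hR : R = Matrix.diagonal r)
    (Ω : Set (Fin n → ℝ)) (hΩ : IsOpen Ω)
    (ν₀ : (Fin n → ℝ) → (Fin m → ℝ)) (hν₀ : Continuous ν₀)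
    (V : (Fin n → ℝ) → ℝ) (hV : ContDiff ℝ 1 V)
    (hLFE : ∀ x ∈ Ω, gradVec V x ⬝ᵥ (f x + g x *ᵥ phiVec φ (ν₀ x)) + Q x
        + Wpen r ψ (phiVec φ (ν₀ x)) = 0)
    (v : (Fin n → ℝ) → (Fin m → ℝ))
    (hvdef : ∀ x, v x = (-(1/2) : ℝ) • (R⁻¹ *ᵥ ((g x)ᵀ *ᵥ gradVec V x))) :
    ∀ I : Set ℝ, I.OrdConnected →
      ∀ (u : ℝ → Fin m → ℝ) (x : ℝ → Fin n → ℝ),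
        ContinuousOn u I → (∀ t ∈ I, x t ∈ Ω) →
        (∀ t ∈ I, HasDerivWithinAt x (f (x t) + g (x t) *ᵥ u t) I t) →
        ∀ t ∈ I, ∀ Δt ≥ (0:ℝ), t + Δt ∈ I →
          V (x t) - V (x (t + Δt))
              + 2 * ∫ τ in t..(t + Δt), v (x τ) ⬝ᵥ R *ᵥ (phiVec φ (ν₀ (x τ)) - u τ)
            = ∫ τ in t..(t + Δt), (Q (x τ) + Wpen r ψ (phiVec φ (ν₀ (x τ)))) := by
  intro I hI u x hu hxΩ hx t ht Δt hΔ htΔ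
  have hle : t ≤ t + Δt := by linarith
  have hsub : Icc t (t + Δt) ⊆ I := hI.out ht htΔ
  have hxc : ContinuousOn x I := fun s hs => (hx s hs).continuousWithinAt
  have hgrad : Continuous (gradVec V) := by
    refine continuous_pi fun j => ?_
    exact (hV.continuous_fderiv one_ne_zero).clm_apply continuous_const
  have hphi : Continuous (fun y => phiVec φ (ν₀ y)) :=
    continuous_pi fun l => hφc.comp ((continuous_apply l).comp hν₀)
  have H : Continuous fun p : (Fin n → ℝ) × (Fin m → ℝ) =>
      gradVec V p.1 ⬝ᵥ (f p.1 + g p.1 *ᵥ p.2) :=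
    (hgrad.comp continuous_fst).dotProduct
      ((hf.comp continuous_fst).add
        ((hg.comp continuous_fst).matrix_mulVec continuous_snd))
  have hD : ContinuousOn (fun τ => gradVec V (x τ) ⬝ᵥ (f (x τ) + g (x τ) *ᵥ u τ))
      (Icc t (t + Δt)) :=
    (H.comp_continuousOn (hxc.prodMk hu)).mono hsub
  have hG : ContinuousOn
      (fun τ => gradVec V (x τ) ⬝ᵥ (f (x τ) + g (x τ) *ᵥ phiVec φ (ν₀ (x τ))))
      (Icc t (t + Δt)) :=
    (H.comp_continuousOn (hxc.prodMk (hphi.comp_continuousOn hxc))).mono hsub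
  have hlin : ∀ y w, fderiv ℝ V y w = gradVec V y ⬝ᵥ w := by
    intro y w
    have := LinearMap.pi_apply_eq_sum_univ (fderiv ℝ V y : (Fin n → ℝ) →ₗ[ℝ] ℝ) w
    simp only [ContinuousLinearMap.coe_coe] at this
    rw [this, dotProduct]
    refine Finset.sum_congr rfl fun j _ => ?_
    rw [smul_eq_mul, mul_comm, gradVec]
    congr 2
    ext k
    simp [Pi.single_apply, eq_comm]
  have hFTC : ∫ τ in t..(t + Δt), gradVec V (x τ) ⬝ᵥ (f (x τ) + g (x τ) *ᵥ u τ)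
      = V (x (t + Δt)) - V (x t) := by
    refine intervalIntegral.integral_eq_sub_of_hasDerivAt_of_le
      (f := fun τ => V (x τ)) hle
      (hV.continuous.comp_continuousOn (hxc.mono hsub)) ?_
      (hD.intervalIntegrable_of_Icc hle)
    intro s hs
    have hI' : I ∈ nhds s := Filter.mem_of_superset (Icc_mem_nhds hs.1 hs.2) hsub
    have h1 := (hx s (hsub (Ioo_subset_Icc_self hs))).hasDerivAt hI'
    have h2 := ((hV.differentiable one_ne_zero) (x s)).hasFDerivAt.comp_hasDerivAt s h1
    rw [hlin] at h2
    exact h2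
  have hRdet : IsUnit R.det := by
    rw [hR, det_diagonal, isUnit_iff_ne_zero]
    exact Finset.prod_ne_zero_iff.mpr fun l _ => (hr l).ne'
  have hRt : Rᵀ = R := by rw [hR, diagonal_transpose]
  have hF : ∀ τ, v (x τ) ⬝ᵥ R *ᵥ (phiVec φ (ν₀ (x τ)) - u τ)
      = (1/2) * (gradVec V (x τ) ⬝ᵥ (f (x τ) + g (x τ) *ᵥ u τ)
        - gradVec V (x τ) ⬝ᵥ (f (x τ) + g (x τ) *ᵥ phiVec φ (ν₀ (x τ)))) := by
    intro τ
    rw [hvdef, dotProduct_mulVec, ← mulVec_transpose, hRt, mulVec_smul, mulVec_mulVec,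
      mul_nonsing_inv _ hRdet, one_mulVec, smul_dotProduct, mulVec_transpose,
      ← dotProduct_mulVec, mulVec_sub, dotProduct_sub, dotProduct_add, dotProduct_add,
      smul_eq_mul]
    ring
  have hQW : ∫ τ in t..(t + Δt), (Q (x τ) + Wpen r ψ (phiVec φ (ν₀ (x τ))))
      = ∫ τ in t..(t + Δt),
        -(gradVec V (x τ) ⬝ᵥ (f (x τ) + g (x τ) *ᵥ phiVec φ (ν₀ (x τ)))) := by
    refine intervalIntegral.integral_congr fun τ hτ => ?_
    rw [uIcc_of_le hle] at hτ
    have := hLFE (x τ) (hxΩ τ (hsub hτ))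
    linarith
  simp_rw [hF]
  rw [hQW, intervalIntegral.integral_neg, intervalIntegral.integral_const_mul,
    intervalIntegral.integral_sub (hD.intervalIntegrable_of_Icc hle)
      (hG.intervalIntegrable_of_Icc hle), hFTC]
  ring
end

section
/- (Forward direction of Theorem 5.1; equation (5.3).) Let Ω ⊆ ℝⁿ be open, let w : ℝⁿ → ℝᵐ be continuous, and let V : ℝⁿ → ℝ be continuously differentiable, satisfying the unconstrained Lyapunov function equation with policy w on Ω. Define v(x) = −(1/2)R⁻¹g(x)ᵀ∇V(x). Then for every continuous control u : I → ℝᵐ and every trajectory x : I → Ω with control u, and all t, t+Δt ∈ I with Δt ≥ 0: V(x(t)) − V(x(t+Δt)) + 2∫_t^{t+Δt} v(x(τ))ᵀR(w(x(τ)) − u(τ)) dτ = ∫_t^{t+Δt} (Q(x(τ)) + w(x(τ))ᵀR w(x(τ))) dτ. -/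
open Matrix Set

/-- **Forward direction of Theorem 5.1 (equation (5.3)).** If `V` solves the
unconstrained Lyapunov function equation with policy `w` on `Ω` and
`v = -(1/2) R⁻¹ gᵀ ∇V`, then `(V, v)` satisfies the unconstrained off-policy integral
equation along every trajectory in `Ω` generated by any continuous control. -/
theorem unconstrained_lfe_implies_integral_equation {n m : ℕ}
    (f : (Fin n → ℝ) → (Fin n → ℝ)) (g : (Fin n → ℝ) → Matrix (Fin n) (Fin m) ℝ)
    (hf : Continuous f) (hg : Continuous g)
    (Q : (Fin n → ℝ) → ℝ) (hQ : Continuous Q)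
    (R : Matrix (Fin m) (Fin m) ℝ) (hRsymm : R.IsSymm) (hRpos : R.PosDef)
    (Ω : Set (Fin n → ℝ)) (hΩ : IsOpen Ω)
    (w : (Fin n → ℝ) → (Fin m → ℝ)) (hw : Continuous w)
    (V : (Fin n → ℝ) → ℝ) (hV : ContDiff ℝ 1 V)
    (hLFE : ∀ x ∈ Ω, gradVec V x ⬝ᵥ (f x + g x *ᵥ w x) + Q x + w x ⬝ᵥ R *ᵥ w x = 0)
    (v : (Fin n → ℝ) → (Fin m → ℝ))
    (hvdef : ∀ x, v x = (-(1/2) : ℝ) • (R⁻¹ *ᵥ ((g x)ᵀ *ᵥ gradVec V x))) :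
    ∀ I : Set ℝ, I.OrdConnected →
      ∀ (u : ℝ → Fin m → ℝ) (x : ℝ → Fin n → ℝ),
        ContinuousOn u I → (∀ t ∈ I, x t ∈ Ω) →
        (∀ t ∈ I, HasDerivWithinAt x (f (x t) + g (x t) *ᵥ u t) I t) →
        ∀ t ∈ I, ∀ Δt ≥ (0:ℝ), t + Δt ∈ I →
          V (x t) - V (x (t + Δt))
              + 2 * ∫ τ in t..(t + Δt), v (x τ) ⬝ᵥ R *ᵥ (w (x τ) - u τ)
            = ∫ τ in t..(t + Δt), (Q (x τ) + w (x τ) ⬝ᵥ R *ᵥ w (x τ)) := by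
  intro I hI u x hu hxΩ hx t ht Δt hΔ htΔ
  have hle : t ≤ t + Δt := by linarith
  have hsub : Icc t (t + Δt) ⊆ I := hI.out ht htΔ
  have hxc : ContinuousOn x (Icc t (t + Δt)) := fun s hs =>
    ((hx s (hsub hs)).continuousWithinAt).mono hsub
  have huc : ContinuousOn u (Icc t (t + Δt)) := hu.mono hsub
  have hgradc : Continuous (gradVec V) := by
    apply continuous_pi
    intro j
    exact (hV.continuous_fderiv one_ne_zero).clm_apply continuous_const
  have hfd : ∀ y z, fderiv ℝ V y z = gradVec V y ⬝ᵥ z := by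
    intro y z
    have h : z = ∑ j, z j • (Pi.single j (1:ℝ) : Fin n → ℝ) := by
      ext i
      simp [Finset.sum_apply, Pi.single_apply]
    conv_lhs => rw [h]
    simp [map_sum, dotProduct, gradVec, mul_comm]
  have hdet : IsUnit R.det := hRpos.det_pos.ne'.isUnit
  have hvR : ∀ y z, 2 * (v y ⬝ᵥ R *ᵥ z) = - (gradVec V y ⬝ᵥ (g y *ᵥ z)) := by
    intro y z
    have h1 : v y ᵥ* R = (-(1/2) : ℝ) • ((g y)ᵀ *ᵥ gradVec V y) := by
      rw [← mulVec_transpose, hRsymm.eq, hvdef, mulVec_smul, mulVec_mulVec,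
        mul_nonsing_inv _ hdet, one_mulVec]
    rw [dotProduct_mulVec, h1, smul_dotProduct, mulVec_transpose, ← dotProduct_mulVec, smul_eq_mul]
    ring
  have hwc : ContinuousOn (fun τ => w (x τ)) (Icc t (t + Δt)) := hw.comp_continuousOn hxc
  have hgc : ContinuousOn (fun τ => g (x τ)) (Icc t (t + Δt)) := hg.comp_continuousOn hxc
  have hfc : ContinuousOn (fun τ => f (x τ)) (Icc t (t + Δt)) := hf.comp_continuousOn hxc
  have hQc : ContinuousOn (fun τ => Q (x τ)) (Icc t (t + Δt)) := hQ.comp_continuousOn hxc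
  have hGc : ContinuousOn (fun τ => gradVec V (x τ)) (Icc t (t + Δt)) :=
    hgradc.comp_continuousOn hxc
  have hmv : ∀ {k l : ℕ} {A : ℝ → Matrix (Fin k) (Fin l) ℝ} {b : ℝ → Fin l → ℝ},
      ContinuousOn A (Icc t (t + Δt)) → ContinuousOn b (Icc t (t + Δt)) →
      ContinuousOn (fun τ => A τ *ᵥ b τ) (Icc t (t + Δt)) := by
    intro k l A b hA hb
    rw [continuousOn_iff_continuous_restrict] at *
    exact hA.matrix_mulVec hb
  have hdp : ∀ {l : ℕ} {a b : ℝ → Fin l → ℝ},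
      ContinuousOn a (Icc t (t + Δt)) → ContinuousOn b (Icc t (t + Δt)) →
      ContinuousOn (fun τ => a τ ⬝ᵥ b τ) (Icc t (t + Δt)) := by
    intro l a b ha hb
    rw [continuousOn_iff_continuous_restrict] at *
    exact ha.dotProduct hb
  have hint : ∀ {F : ℝ → ℝ}, ContinuousOn F (Icc t (t + Δt)) →
      IntervalIntegrable F MeasureTheory.volume t (t + Δt) :=
    fun h => ContinuousOn.intervalIntegrable_of_Icc hle h
  have hI1 := hint (hdp hGc (hfc.add (hmv hgc huc)))
  have hI2 := hint (hdp hGc (hmv hgc (hwc.sub huc)))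
  have hFTC := intervalIntegral.integral_eq_sub_of_hasDerivAt_of_le hle
    (f := fun τ => V (x τ)) (hV.continuous.comp_continuousOn hxc)
    (fun s hs => by
      have hs' : I ∈ nhds s :=
        Filter.mem_of_superset (Icc_mem_nhds hs.1 hs.2) hsub
      have h1 := (hx s (mem_of_mem_nhds hs')).hasDerivAt hs'
      have h2 := ((hV.differentiable one_ne_zero) (x s)).hasFDerivAt.comp_hasDerivAt s h1
      rw [hfd] at h2
      exact h2) hI1
  have e1 : 2 * ∫ τ in t..(t + Δt), v (x τ) ⬝ᵥ R *ᵥ (w (x τ) - u τ)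
      = - ∫ τ in t..(t + Δt), gradVec V (x τ) ⬝ᵥ (g (x τ) *ᵥ (w (x τ) - u τ)) := by
    rw [← intervalIntegral.integral_const_mul, ← intervalIntegral.integral_neg]
    simp only [hvR]
  have e2 : ∫ τ in t..(t + Δt), (Q (x τ) + w (x τ) ⬝ᵥ R *ᵥ w (x τ))
      = ∫ τ in t..(t + Δt), (- (gradVec V (x τ) ⬝ᵥ (f (x τ) + g (x τ) *ᵥ u τ))
        - gradVec V (x τ) ⬝ᵥ (g (x τ) *ᵥ (w (x τ) - u τ))) := by
    apply intervalIntegral.integral_congr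
    intro s hs
    rw [uIcc_of_le hle] at hs
    have h := hLFE (x s) (hxΩ s (hsub hs))
    simp only [dotProduct_add, mulVec_sub, dotProduct_sub] at h ⊢
    linarith
  have e3 := intervalIntegral.integral_sub hI1.neg hI2
  simp only [Pi.neg_apply, Pi.sub_apply, Pi.add_apply] at e3 hFTC
  rw [e1, e2]
  refine Eq.trans ?_ e3.symm
  rw [intervalIntegral.integral_neg]
  linarith [hFTC]
end

section
/- (Equation (5.2): off-policy derivative identity, unconstrained case.) Let Ω ⊆ ℝⁿ be open, let w : ℝⁿ → ℝᵐ be continuous, and let V : ℝⁿ → ℝ be continuously differentiable, satisfying the unconstrained Lyapunov function equation with policy w on Ω. Define v(x) = −(1/2)R⁻¹g(x)ᵀ∇V(x). Then for every control u : I → ℝᵐ and every trajectory x : I → Ω with control u, the function t ↦ V(x(t)) is differentiable on I with derivative d/dt V(x(t)) = −Q(x(t)) − w(x(t))ᵀR w(x(t)) + 2 v(x(t))ᵀR(w(x(t)) − u(t)) for all t ∈ I. -/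
open Matrix Set

/-- **Equation (5.2): off-policy derivative identity, unconstrained case.** If `V`
solves the unconstrained Lyapunov function equation with policy `w` on `Ω` and
`v = -(1/2) R⁻¹ gᵀ ∇V`, then along every trajectory in `Ω` with control `u`,
`d/dt V(x(t)) = -Q(x(t)) - w(x(t))ᵀ R w(x(t)) + 2 v(x(t))ᵀ R (w(x(t)) - u(t))`. -/
theorem unconstrained_offpolicy_derivative_identity {n m : ℕ}
    (f : (Fin n → ℝ) → (Fin n → ℝ)) (g : (Fin n → ℝ) → Matrix (Fin n) (Fin m) ℝ)
    (hf : Continuous f) (hg : Continuous g)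
    (Q : (Fin n → ℝ) → ℝ) (hQ : Continuous Q)
    (R : Matrix (Fin m) (Fin m) ℝ) (hRsymm : R.IsSymm) (hRpos : R.PosDef)
    (Ω : Set (Fin n → ℝ)) (hΩ : IsOpen Ω)
    (w : (Fin n → ℝ) → (Fin m → ℝ)) (hw : Continuous w)
    (V : (Fin n → ℝ) → ℝ) (hV : ContDiff ℝ 1 V)
    (hLFE : ∀ x ∈ Ω, gradVec V x ⬝ᵥ (f x + g x *ᵥ w x) + Q x + w x ⬝ᵥ R *ᵥ w x = 0)
    (v : (Fin n → ℝ) → (Fin m → ℝ))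
    (hvdef : ∀ x, v x = (-(1/2) : ℝ) • (R⁻¹ *ᵥ ((g x)ᵀ *ᵥ gradVec V x))) :
    ∀ I : Set ℝ, I.OrdConnected →
      ∀ (u : ℝ → Fin m → ℝ) (x : ℝ → Fin n → ℝ),
        (∀ t ∈ I, x t ∈ Ω) →
        (∀ t ∈ I, HasDerivWithinAt x (f (x t) + g (x t) *ᵥ u t) I t) →
        ∀ t ∈ I, HasDerivWithinAt (fun s => V (x s))
          (-Q (x t) - w (x t) ⬝ᵥ R *ᵥ w (x t)
            + 2 * (v (x t) ⬝ᵥ R *ᵥ (w (x t) - u t))) I t := by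
  intro I _ u x hxΩ hx t ht
  have hL := hLFE (x t) (hxΩ t ht)
  have hd : HasFDerivAt V (fderiv ℝ V (x t)) (x t) :=
    (hV.differentiable (by norm_num) (x t)).hasFDerivAt
  have hc := hd.comp_hasDerivWithinAt t (hx t ht)
  have hgrad : ∀ y : Fin n → ℝ, fderiv ℝ V (x t) y = gradVec V (x t) ⬝ᵥ y := by
    intro y
    conv_lhs => rw [pi_eq_sum_univ' y]
    simp only [map_sum, map_smul, smul_eq_mul, dotProduct, gradVec]
    refine Finset.sum_congr rfl fun i _ => ?_
    rw [mul_comm]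
  have hdet : IsUnit R.det := (Matrix.isUnit_iff_isUnit_det R).1 hRpos.isUnit
  have hRv : R *ᵥ v (x t) = (-(1/2) : ℝ) • ((g (x t))ᵀ *ᵥ gradVec V (x t)) := by
    rw [hvdef, mulVec_smul, mulVec_mulVec, Matrix.mul_nonsing_inv R hdet, one_mulVec]
  have hkey : v (x t) ⬝ᵥ R *ᵥ (w (x t) - u t)
      = -(1/2) * (gradVec V (x t) ⬝ᵥ g (x t) *ᵥ (w (x t) - u t)) := by
    rw [dotProduct_mulVec, ← mulVec_transpose, hRsymm.eq, hRv, smul_dotProduct, smul_eq_mul,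
      mulVec_transpose, ← dotProduct_mulVec]
  refine hc.congr_deriv ?_
  rw [hgrad, hkey, mulVec_sub, dotProduct_sub, dotProduct_add]
  rw [dotProduct_add] at hL
  linarith
end

section
/- (The integral equation implies the pointwise equation, unconstrained case.) Let Ω ⊆ ℝⁿ be open, let w : ℝⁿ → ℝᵐ be continuous, let V : ℝⁿ → ℝ be continuously differentiable, and let v : Ω → ℝᵐ be continuous. Fix x₀ ∈ Ω and u₀ ∈ ℝᵐ, and suppose there exist ε > 0, a continuous control u : [0,ε) → ℝᵐ with u(0) = u₀, and a trajectory x : [0,ε) → Ω with control u and x(0) = x₀, such that (V, v) satisfies the unconstrained off-policy integral equation for this control and trajectory (for all 0 ≤ t ≤ t+Δt < ε). Then ∇V(x₀)ᵀ(f(x₀) + g(x₀)u₀) = 2 v(x₀)ᵀR(w(x₀) − u₀) − Q(x₀) − w(x₀)ᵀR w(x₀). -/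
open Matrix Set

/-- One-sided derivative at `0` of the integral of a function continuous on `[0, ε)`. -/
theorem aux_deriv_integral {ε : ℝ} (hε : 0 < ε) {φ : ℝ → ℝ} (hφ : ContinuousOn φ (Ico 0 ε)) :
    HasDerivWithinAt (fun t => ∫ τ in (0:ℝ)..t, φ τ) (φ 0) (Ici 0) 0 := by
  have hmem : Ico (0:ℝ) ε ∈ nhdsWithin (0:ℝ) (Ici 0) := Ico_mem_nhdsGE hε
  have hmem' : Ico (0:ℝ) ε ∈ nhdsWithin (0:ℝ) (Ioi 0) :=
    nhdsWithin_mono _ Ioi_subset_Ici_self hmem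
  refine intervalIntegral.integral_hasDerivWithinAt_right (t := Ioi 0)
    IntervalIntegrable.refl ?_ ?_
  · exact ⟨Ico 0 ε, hmem', hφ.aestronglyMeasurable measurableSet_Ico⟩
  · exact ((hφ 0 ⟨le_rfl, hε⟩).mono_of_mem_nhdsWithin hmem')

/-- **The integral equation implies the pointwise equation, unconstrained case.**
If `(V, v)` satisfies the unconstrained off-policy integral equation along some
trajectory starting at `x₀ ∈ Ω` with continuous control starting at `u₀`, then
`∇V(x₀)ᵀ(f(x₀)+g(x₀)u₀) = 2 v(x₀)ᵀ R (w(x₀) - u₀) - Q(x₀) - w(x₀)ᵀ R w(x₀)`. -/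
theorem unconstrained_integral_implies_pointwise {n m : ℕ}
    (f : (Fin n → ℝ) → (Fin n → ℝ)) (g : (Fin n → ℝ) → Matrix (Fin n) (Fin m) ℝ)
    (hf : Continuous f) (hg : Continuous g)
    (Q : (Fin n → ℝ) → ℝ) (hQ : Continuous Q)
    (R : Matrix (Fin m) (Fin m) ℝ) (hRsymm : R.IsSymm) (hRpos : R.PosDef)
    (Ω : Set (Fin n → ℝ)) (hΩ : IsOpen Ω)
    (w : (Fin n → ℝ) → (Fin m → ℝ)) (hw : Continuous w)
    (V : (Fin n → ℝ) → ℝ) (hV : ContDiff ℝ 1 V)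
    (v : (Fin n → ℝ) → (Fin m → ℝ)) (hv : ContinuousOn v Ω)
    (x₀ : Fin n → ℝ) (hx₀ : x₀ ∈ Ω) (u₀ : Fin m → ℝ)
    (hex : ∃ ε > (0:ℝ), ∃ u : ℝ → (Fin m → ℝ), ∃ x : ℝ → (Fin n → ℝ),
      ContinuousOn u (Ico 0 ε) ∧ u 0 = u₀ ∧
      x 0 = x₀ ∧ (∀ t ∈ Ico (0:ℝ) ε, x t ∈ Ω) ∧
      (∀ t ∈ Ico (0:ℝ) ε, HasDerivWithinAt x (f (x t) + g (x t) *ᵥ u t) (Ico 0 ε) t) ∧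
      (∀ t ∈ Ico (0:ℝ) ε, ∀ Δt ≥ (0:ℝ), t + Δt ∈ Ico (0:ℝ) ε →
        V (x t) - V (x (t + Δt))
            + 2 * ∫ τ in t..(t + Δt), v (x τ) ⬝ᵥ R *ᵥ (w (x τ) - u τ)
          = ∫ τ in t..(t + Δt), (Q (x τ) + w (x τ) ⬝ᵥ R *ᵥ w (x τ)))) :
    gradVec V x₀ ⬝ᵥ (f x₀ + g x₀ *ᵥ u₀)
      = 2 * (v x₀ ⬝ᵥ R *ᵥ (w x₀ - u₀)) - Q x₀ - w x₀ ⬝ᵥ R *ᵥ w x₀ := by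
  obtain ⟨ε, hε, u, x, hu, hu0, hx0, hxΩ, hx, heq⟩ := hex
  have h0 : (0:ℝ) ∈ Ico (0:ℝ) ε := ⟨le_rfl, hε⟩
  have hxc : ContinuousOn x (Ico 0 ε) := fun t ht => (hx t ht).continuousWithinAt
  have hvc : ContinuousOn (fun t => v (x t)) (Ico 0 ε) := hv.comp hxc hxΩ
  have hwc : ContinuousOn (fun t => w (x t)) (Ico 0 ε) := hw.comp_continuousOn hxc
  have hQc : ContinuousOn (fun t => Q (x t)) (Ico 0 ε) := hQ.comp_continuousOn hxc
  have hdot : ∀ a b : ℝ → (Fin m → ℝ), ContinuousOn a (Ico 0 ε) → ContinuousOn b (Ico 0 ε) →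
      ContinuousOn (fun t => a t ⬝ᵥ R *ᵥ b t) (Ico 0 ε) := by
    intro a b ha hb
    have hc : Continuous (fun p : (Fin m → ℝ) × (Fin m → ℝ) => p.1 ⬝ᵥ R *ᵥ p.2) :=
      continuous_fst.dotProduct (continuous_const.matrix_mulVec continuous_snd)
    exact hc.comp_continuousOn (ha.prodMk hb)
  have hmem : Ico (0:ℝ) ε ∈ nhdsWithin (0:ℝ) (Ici 0) := Ico_mem_nhdsGE hε
  have d1 := aux_deriv_integral hε (hdot _ _ hvc (hwc.sub hu))
  have d2 := aux_deriv_integral hε (hQc.add (hdot _ _ hwc hwc))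
  have dx : HasDerivWithinAt x (f x₀ + g x₀ *ᵥ u₀) (Ici 0) 0 := by
    have := (hx 0 h0).mono_of_mem_nhdsWithin hmem
    rwa [hx0, hu0] at this
  have dV : HasDerivWithinAt (fun t => V (x t)) (fderiv ℝ V x₀ (f x₀ + g x₀ *ᵥ u₀)) (Ici 0) 0 := by
    have hd : HasFDerivAt V (fderiv ℝ V x₀) (x 0) := by
      rw [hx0]
      exact (hV.differentiable one_ne_zero x₀).hasFDerivAt
    exact hd.comp_hasDerivWithinAt 0 dx
  have dR := ((d1.const_mul 2).sub d2).const_add (V x₀)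
  have dV' := dR.congr_of_eventuallyEq (f₁ := fun t => V (x t)) (by
    filter_upwards [hmem] with t ht
    have := heq 0 h0 t ht.1 (by simpa using ht)
    simp only [zero_add, hx0] at this
    simp only [Pi.sub_apply, Pi.add_apply]
    linarith) (by simp [hx0])
  have hkey := (uniqueDiffWithinAt_Ici (0:ℝ)).eq_deriv _ dV dV'
  have hgrad : gradVec V x₀ ⬝ᵥ (f x₀ + g x₀ *ᵥ u₀) = fderiv ℝ V x₀ (f x₀ + g x₀ *ᵥ u₀) := by
    generalize f x₀ + g x₀ *ᵥ u₀ = y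
    conv_rhs => rw [pi_eq_sum_univ' y]
    simp [gradVec, dotProduct, map_sum, mul_comm]
  rw [hgrad, hkey]
  simp only [Pi.sub_apply, Pi.add_apply, hx0, hu0]
  ring
end

section
/- (The pointwise equation determines the LFE and the policy, constrained case.) Let Ω ⊆ ℝⁿ, let U ⊆ ℝᵐ, let ν⁰ : ℝⁿ → ℝᵐ with φ(ν⁰(x)) ∈ U for all x ∈ Ω, and suppose for every x ∈ Ω the linear span of {u − φ(ν⁰(x)) : u ∈ U} is all of ℝᵐ. Let V : ℝⁿ → ℝ be continuously differentiable and v : Ω → ℝᵐ a map such that for all x ∈ Ω and all u ∈ U: ∇V(x)ᵀ(f(x) + g(x)u) = 2 v(x)ᵀR(φ(ν⁰(x)) − u) − Q(x) − W(φ(ν⁰(x))). Then V satisfies the constrained Lyapunov function equation with policy ν⁰ on Ω, i.e. ∇V(x)ᵀ(f(x) + g(x)φ(ν⁰(x))) + Q(x) + W(φ(ν⁰(x))) = 0 for all x ∈ Ω, and v(x) = −(1/2)R⁻¹g(x)ᵀ∇V(x) for all x ∈ Ω. -/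
open Matrix Set

/-- **The pointwise equation determines the LFE and the policy, constrained case.**
If `∇V(x)ᵀ(f(x)+g(x)u) = 2 v(x)ᵀ R (φ(ν⁰(x)) - u) - Q(x) - W(φ(ν⁰(x)))` for all
`x ∈ Ω` and all `u ∈ U`, where the differences `u - φ(ν⁰(x))` span `ℝᵐ`, then `V`
satisfies the constrained LFE with policy `ν⁰` on `Ω` and `v = -(1/2) R⁻¹ gᵀ ∇V`. -/
theorem constrained_pointwise_determines_lfe_and_policy {n m : ℕ}
    (f : (Fin n → ℝ) → (Fin n → ℝ)) (g : (Fin n → ℝ) → Matrix (Fin n) (Fin m) ℝ)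
    (hf : Continuous f) (hg : Continuous g)
    (Q : (Fin n → ℝ) → ℝ) (hQ : Continuous Q)
    (β : ℝ) (hβ : 0 < β)
    (φ ψ : ℝ → ℝ) (hφc : Continuous φ) (hφmono : StrictMono φ)
    (hφodd : ∀ s : ℝ, φ (-s) = -φ s) (hφrange : Set.range φ = Ioo (-β) β)
    (hψ : ∀ s : ℝ, ψ (φ s) = s)
    (r : Fin m → ℝ) (hr : ∀ l, 0 < r l)
    (R : Matrix (Fin m) (Fin m) ℝ) (hR : R = Matrix.diagonal r)
    (Ω : Set (Fin n → ℝ)) (U : Set (Fin m → ℝ))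
    (ν₀ : (Fin n → ℝ) → (Fin m → ℝ)) (hν₀U : ∀ x ∈ Ω, phiVec φ (ν₀ x) ∈ U)
    (hspan : ∀ x ∈ Ω,
      Submodule.span ℝ {d : Fin m → ℝ | ∃ u ∈ U, d = u - phiVec φ (ν₀ x)} = ⊤)
    (V : (Fin n → ℝ) → ℝ) (hV : ContDiff ℝ 1 V)
    (v : (Fin n → ℝ) → (Fin m → ℝ))
    (hpt : ∀ x ∈ Ω, ∀ u ∈ U,
      gradVec V x ⬝ᵥ (f x + g x *ᵥ u)
        = 2 * (v x ⬝ᵥ R *ᵥ (phiVec φ (ν₀ x) - u)) - Q x - Wpen r ψ (phiVec φ (ν₀ x))) :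
    (∀ x ∈ Ω, gradVec V x ⬝ᵥ (f x + g x *ᵥ phiVec φ (ν₀ x)) + Q x
        + Wpen r ψ (phiVec φ (ν₀ x)) = 0) ∧
    (∀ x ∈ Ω, v x = (-(1/2) : ℝ) • (R⁻¹ *ᵥ ((g x)ᵀ *ᵥ gradVec V x))) := by
  have h1 : ∀ x ∈ Ω, gradVec V x ⬝ᵥ (f x + g x *ᵥ phiVec φ (ν₀ x)) + Q x
        + Wpen r ψ (phiVec φ (ν₀ x)) = 0 := by
    intro x hx
    have h := hpt x hx _ (hν₀U x hx)
    rw [sub_self, Matrix.mulVec_zero, dotProduct_zero] at h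
    linarith
  refine ⟨h1, fun x hx => ?_⟩
  have key : ∀ d : Fin m → ℝ,
      gradVec V x ⬝ᵥ (g x *ᵥ d) + 2 * (v x ⬝ᵥ R *ᵥ d) = 0 := by
    intro d
    have hd : d ∈ Submodule.span ℝ {d : Fin m → ℝ | ∃ u ∈ U, d = u - phiVec φ (ν₀ x)} := by
      rw [hspan x hx]; trivial
    induction hd using Submodule.span_induction with
    | mem d hd =>
      obtain ⟨u, hu, rfl⟩ := hd
      have h := hpt x hx u hu
      have h' := h1 x hx
      simp only [Matrix.mulVec_sub, dotProduct_add, dotProduct_sub] at h h' ⊢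
      linarith
    | zero => simp
    | add a b _ _ ha hb =>
      simp only [Matrix.mulVec_add, dotProduct_add]
      linarith
    | smul c a _ ha =>
      simp only [Matrix.mulVec_smul, dotProduct_smul, smul_eq_mul]
      linear_combination c * ha
  have hw : ∀ l, ((g x)ᵀ *ᵥ gradVec V x) l = -2 * (r l * v x l) := by
    intro l
    have h := key (Pi.single l 1)
    rw [Matrix.dotProduct_mulVec, Matrix.dotProduct_mulVec, dotProduct_single,
      dotProduct_single, hR, Matrix.vecMul_diagonal] at h
    rw [Matrix.mulVec_transpose]
    linarith
  have hw' : (g x)ᵀ *ᵥ gradVec V x = R *ᵥ ((-2 : ℝ) • v x) := by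
    ext l
    rw [hw l, hR, Matrix.mulVec_diagonal, Pi.smul_apply, smul_eq_mul]
    ring
  have hdet : IsUnit R.det := by
    rw [hR, Matrix.det_diagonal]
    exact (Finset.prod_ne_zero_iff.mpr fun l _ => (hr l).ne').isUnit
  rw [hw', Matrix.mulVec_mulVec, Matrix.nonsing_inv_mul _ hdet, Matrix.one_mulVec, smul_smul]
  norm_num
end

section
/- (The pointwise equation determines the LFE and the policy, unconstrained case.) Let Ω ⊆ ℝⁿ, let U ⊆ ℝᵐ, let w : ℝⁿ → ℝᵐ with w(x) ∈ U for all x ∈ Ω, and suppose for every x ∈ Ω the linear span of {u − w(x) : u ∈ U} is all of ℝᵐ. Let V : ℝⁿ → ℝ be continuously differentiable and v : Ω → ℝᵐ a map such that for all x ∈ Ω and all u ∈ U: ∇V(x)ᵀ(f(x) + g(x)u) = 2 v(x)ᵀR(w(x) − u) − Q(x) − w(x)ᵀR w(x). Then V satisfies the unconstrained Lyapunov function equation with policy w on Ω, i.e. ∇V(x)ᵀ(f(x) + g(x)w(x)) + Q(x) + w(x)ᵀR w(x) = 0 for all x ∈ Ω, and v(x) = −(1/2)R⁻¹g(x)ᵀ∇V(x)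 for all x ∈ Ω. -/
open Matrix Set

/-- **The pointwise equation determines the LFE and the policy, unconstrained case.**
If `∇V(x)ᵀ(f(x)+g(x)u) = 2 v(x)ᵀ R (w(x) - u) - Q(x) - w(x)ᵀ R w(x)` for all `x ∈ Ω`
and all `u ∈ U`, where the differences `u - w(x)` span `ℝᵐ`, then `V` satisfies the
unconstrained LFE with policy `w` on `Ω` and `v = -(1/2) R⁻¹ gᵀ ∇V`. -/
theorem unconstrained_pointwise_determines_lfe_and_policy {n m : ℕ}
    (f : (Fin n → ℝ) → (Fin n → ℝ)) (g : (Fin n → ℝ) → Matrix (Fin n) (Fin m) ℝ)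
    (hf : Continuous f) (hg : Continuous g)
    (Q : (Fin n → ℝ) → ℝ) (hQ : Continuous Q)
    (R : Matrix (Fin m) (Fin m) ℝ) (hRsymm : R.IsSymm) (hRpos : R.PosDef)
    (Ω : Set (Fin n → ℝ)) (U : Set (Fin m → ℝ))
    (w : (Fin n → ℝ) → (Fin m → ℝ)) (hwU : ∀ x ∈ Ω, w x ∈ U)
    (hspan : ∀ x ∈ Ω, Submodule.span ℝ {d : Fin m → ℝ | ∃ u ∈ U, d = u - w x} = ⊤)
    (V : (Fin n → ℝ) → ℝ) (hV : ContDiff ℝ 1 V)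
    (v : (Fin n → ℝ) → (Fin m → ℝ))
    (hpt : ∀ x ∈ Ω, ∀ u ∈ U,
      gradVec V x ⬝ᵥ (f x + g x *ᵥ u)
        = 2 * (v x ⬝ᵥ R *ᵥ (w x - u)) - Q x - w x ⬝ᵥ R *ᵥ w x) :
    (∀ x ∈ Ω, gradVec V x ⬝ᵥ (f x + g x *ᵥ w x) + Q x + w x ⬝ᵥ R *ᵥ w x = 0) ∧
    (∀ x ∈ Ω, v x = (-(1/2) : ℝ) • (R⁻¹ *ᵥ ((g x)ᵀ *ᵥ gradVec V x))) := by
  have h1 : ∀ x ∈ Ω, gradVec V x ⬝ᵥ (f x + g x *ᵥ w x) + Q x + w x ⬝ᵥ R *ᵥ w x = 0 := by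
    intro x hx
    have h := hpt x hx (w x) (hwU x hx)
    simp only [sub_self, mulVec_zero, dotProduct_zero] at h
    linarith
  refine ⟨h1, fun x hx => ?_⟩
  have h2 : ∀ d : Fin m → ℝ,
      gradVec V x ⬝ᵥ (g x *ᵥ d) + 2 * (v x ⬝ᵥ R *ᵥ d) = 0 := by
    intro d
    have hd : d ∈ Submodule.span ℝ {d : Fin m → ℝ | ∃ u ∈ U, d = u - w x} := by
      rw [hspan x hx]; trivial
    induction hd using Submodule.span_induction with
    | mem d hd =>
      obtain ⟨u, hu, rfl⟩ := hd
      have ha := hpt x hx u hu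
      have hb := h1 x hx
      simp only [mulVec_sub, dotProduct_sub, dotProduct_add] at ha hb ⊢
      linarith
    | zero => simp
    | add a b _ _ ha hb =>
      simp only [mulVec_add, dotProduct_add]
      linarith
    | smul c a _ ha =>
      simp only [mulVec_smul, dotProduct_smul, smul_eq_mul]
      linear_combination c * ha
  have h3 : (g x)ᵀ *ᵥ gradVec V x + (2 : ℝ) • (R *ᵥ v x) = 0 := by
    apply dotProduct_eq_zero
    intro d
    have h := h2 d
    rw [dotProduct_mulVec, dotProduct_mulVec, ← mulVec_transpose, ← mulVec_transpose,
      hRsymm.eq] at h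
    rw [add_dotProduct, smul_dotProduct, smul_eq_mul]
    exact h
  have h4 : (g x)ᵀ *ᵥ gradVec V x = (-2 : ℝ) • (R *ᵥ v x) := by
    rw [neg_smul]
    exact eq_neg_of_add_eq_zero_left h3
  have hdet : IsUnit R.det := (Matrix.isUnit_iff_isUnit_det R).1 hRpos.isUnit
  rw [h4, mulVec_smul, mulVec_mulVec, Matrix.nonsing_inv_mul R hdet, one_mulVec, smul_smul]
  norm_num
end

section
/- (Uniqueness of the Lyapunov function equation solution along stabilizing trajectories; step (4.9) in the proof of Theorem 4.1.) Let Ω ⊆ ℝⁿ with 0 ∈ Ω, let w : Ω → ℝᵐ and c : Ω → ℝ be continuous, and assume that for every x₀ ∈ Ω there exists a differentiable function x : [0,∞) → Ω with x(0) = x₀, ẋ(t) = f(x(t)) + g(x(t))w(x(t)) for all t ≥ 0, and x(t) → 0 as t → ∞. If V, W : ℝⁿ → ℝ are continuously differentiable with V(0) = W(0) = 0 and both satisfy ∇V(x)ᵀ(f(x) + g(x)w(x)) + c(x) = 0 and ∇W(x)ᵀ(f(x) + g(x)w(x)) + c(x) = 0 for all x ∈ Ω, then V(x) = W(x) for all x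 ∈ Ω. -/
open Matrix Set Filter

theorem gradVec_dot_aux {n : ℕ} (V : (Fin n → ℝ) → ℝ) (x v : Fin n → ℝ) :
    fderiv ℝ V x v = gradVec V x ⬝ᵥ v := by
  conv_lhs => rw [pi_eq_sum_univ' v]
  simp only [map_sum, map_smul, dotProduct, gradVec, smul_eq_mul]
  refine Finset.sum_congr rfl fun j _ => ?_
  rw [mul_comm]

/-- **Uniqueness of the Lyapunov function equation solution along stabilizing
trajectories (step (4.9) of the proof of Theorem 4.1).** If every point of `Ω` is the
initial state of a closed-loop trajectory (with feedback `w`) that stays in `Ω` and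
converges to `0`, then two `C¹` solutions of `∇V(x)ᵀ(f(x)+g(x)w(x)) + c(x) = 0` on `Ω`
vanishing at `0` coincide on `Ω`. -/
theorem lfe_solution_unique {n m : ℕ}
    (f : (Fin n → ℝ) → (Fin n → ℝ)) (g : (Fin n → ℝ) → Matrix (Fin n) (Fin m) ℝ)
    (hf : Continuous f) (hg : Continuous g)
    (Ω : Set (Fin n → ℝ)) (h0Ω : (0 : Fin n → ℝ) ∈ Ω)
    (w : (Fin n → ℝ) → (Fin m → ℝ)) (hw : ContinuousOn w Ω)
    (c : (Fin n → ℝ) → ℝ) (hc : ContinuousOn c Ω)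
    (htraj : ∀ x₀ ∈ Ω, ∃ x : ℝ → (Fin n → ℝ), x 0 = x₀ ∧
      (∀ t ∈ Ici (0:ℝ), x t ∈ Ω) ∧
      (∀ t ∈ Ici (0:ℝ),
        HasDerivWithinAt x (f (x t) + g (x t) *ᵥ w (x t)) (Ici 0) t) ∧
      Tendsto x atTop (nhds 0))
    (V W : (Fin n → ℝ) → ℝ) (hV : ContDiff ℝ 1 V) (hW : ContDiff ℝ 1 W)
    (hV0 : V 0 = 0) (hW0 : W 0 = 0)
    (hVlfe : ∀ x ∈ Ω, gradVec V x ⬝ᵥ (f x + g x *ᵥ w x) + c x = 0)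
    (hWlfe : ∀ x ∈ Ω, gradVec W x ⬝ᵥ (f x + g x *ᵥ w x) + c x = 0) :
    ∀ x ∈ Ω, V x = W x := by
  intro x₀ hx₀
  obtain ⟨x, hx0, hxΩ, hxd, hxt⟩ := htraj x₀ hx₀
  have hd : ∀ t ∈ Ici (0:ℝ), HasDerivWithinAt (fun t => V (x t) - W (x t)) 0 (Ici 0) t := by
    intro t ht
    have h1 := ((hV.differentiable (by norm_num)) (x t)).hasFDerivAt.comp_hasDerivWithinAt t
      (hxd t ht)
    have h2 := ((hW.differentiable (by norm_num)) (x t)).hasFDerivAt.comp_hasDerivWithinAt t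
      (hxd t ht)
    have h3 := h1.sub h2
    rw [gradVec_dot_aux, gradVec_dot_aux] at h3
    have e1 := hVlfe _ (hxΩ t ht)
    have e2 := hWlfe _ (hxΩ t ht)
    have e3 : gradVec V (x t) ⬝ᵥ (f (x t) + g (x t) *ᵥ w (x t))
      - gradVec W (x t) ⬝ᵥ (f (x t) + g (x t) *ᵥ w (x t)) = 0 := by linarith
    rw [e3] at h3
    exact h3
  have hconst : ∀ t ∈ Ici (0:ℝ), V (x t) - W (x t) = V (x 0) - W (x 0) := by
    intro t ht
    have := (convex_Ici (0:ℝ)).norm_image_sub_le_of_norm_hasDerivWithin_le (C := 0) hd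
      (by simp) (mem_Ici.mpr le_rfl) ht
    rw [zero_mul] at this
    exact sub_eq_zero.mp (norm_le_zero_iff.mp this)
  have hlim : Tendsto (fun t => V (x t) - W (x t)) atTop (nhds (V 0 - W 0)) :=
    ((hV.continuous.tendsto 0).comp hxt).sub ((hW.continuous.tendsto 0).comp hxt)
  have hlim2 : Tendsto (fun t => V (x t) - W (x t)) atTop (nhds (V (x 0) - W (x 0))) := by
    refine tendsto_const_nhds.congr' ?_
    filter_upwards [eventually_ge_atTop (0:ℝ)] with t ht
    exact (hconst t ht).symm
  have := tendsto_nhds_unique hlim hlim2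
  rw [hV0, hW0, hx0] at this
  linarith
end

section
/- (Linear case, forward direction of equation (5.24).) Let K ∈ ℝ^{m×n} and let P ∈ ℝ^{n×n} be a symmetric matrix satisfying the Lyapunov matrix equation (A − BK)ᵀP + P(A − BK) + Q + KᵀRK = 0, and set K⁺ = R⁻¹BᵀP. Then for every continuous control u : I → ℝᵐ, every trajectory x : I → ℝⁿ with control u, and all t, t+Δt ∈ I with Δt ≥ 0: x(t)ᵀPx(t) − x(t+Δt)ᵀPx(t+Δt) + 2∫_t^{t+Δt} (Kx(τ) + u(τ))ᵀR K⁺ x(τ) dτ = ∫_t^{t+Δt} x(τ)ᵀ(Q + KᵀRK)x(τ) dτ. -/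
open Matrix Set

/-- Derivative of a dot product of two vector-valued curves. -/
lemma hasDerivWithinAt_dotProduct_aux {n : ℕ} {x y : ℝ → Fin n → ℝ} {x' y' : Fin n → ℝ}
    {s : Set ℝ} {t : ℝ} (hx : HasDerivWithinAt x x' s t) (hy : HasDerivWithinAt y y' s t) :
    HasDerivWithinAt (fun τ => x τ ⬝ᵥ y τ) (x' ⬝ᵥ y t + x t ⬝ᵥ y') s t := by
  rw [hasDerivWithinAt_pi] at hx hy
  have h := HasDerivWithinAt.fun_sum (u := Finset.univ) (fun i _ => (hx i).fun_mul (hy i))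
  simpa [dotProduct, Finset.sum_add_distrib] using h

lemma hasDerivWithinAt_mulVec_aux {n k : ℕ} (P : Matrix (Fin k) (Fin n) ℝ)
    {x : ℝ → Fin n → ℝ} {x' : Fin n → ℝ}
    {s : Set ℝ} {t : ℝ} (hx : HasDerivWithinAt x x' s t) :
    HasDerivWithinAt (fun τ => P *ᵥ x τ) (P *ᵥ x') s t := by
  rw [hasDerivWithinAt_pi] at hx ⊢
  intro i
  have h := HasDerivWithinAt.fun_sum (u := Finset.univ)
    (fun j _ => (hx j).const_mul (P i j))
  simpa [mulVec, dotProduct] using h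

/-- The pointwise algebraic identity. -/
lemma lyapunov_pointwise_aux {n m : ℕ}
    (A : Matrix (Fin n) (Fin n) ℝ) (B : Matrix (Fin n) (Fin m) ℝ)
    (Q : Matrix (Fin n) (Fin n) ℝ)
    (R : Matrix (Fin m) (Fin m) ℝ) (hRpos : R.PosDef)
    (K : Matrix (Fin m) (Fin n) ℝ)
    (P : Matrix (Fin n) (Fin n) ℝ) (hPsymm : P.IsSymm)
    (hLyap : (A - B * K)ᵀ * P + P * (A - B * K) + Q + Kᵀ * R * K = 0)
    (Kplus : Matrix (Fin m) (Fin n) ℝ) (hKplus : Kplus = R⁻¹ * Bᵀ * P)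
    (x : Fin n → ℝ) (u : Fin m → ℝ) :
    (A *ᵥ x + B *ᵥ u) ⬝ᵥ P *ᵥ x + x ⬝ᵥ P *ᵥ (A *ᵥ x + B *ᵥ u)
      = 2 * ((K *ᵥ x + u) ⬝ᵥ R *ᵥ (Kplus *ᵥ x)) - x ⬝ᵥ (Q + Kᵀ * R * K) *ᵥ x := by
  have hdet : IsUnit R.det := hRpos.det_pos.ne'.isUnit
  have hRK : R * Kplus = Bᵀ * P := by
    rw [hKplus, Matrix.mul_assoc, Matrix.mul_nonsing_inv_cancel_left _ _ hdet]
  have hS : ∀ a b : Fin n → ℝ, a ⬝ᵥ P *ᵥ b = b ⬝ᵥ P *ᵥ a := by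
    intro a b
    rw [dotProduct_mulVec, dotProduct_comm, ← mulVec_transpose, hPsymm.eq]
  have hT : ∀ {k l : ℕ} (M : Matrix (Fin k) (Fin l) ℝ) (a : Fin l → ℝ) (b : Fin k → ℝ),
      a ⬝ᵥ Mᵀ *ᵥ b = (M *ᵥ a) ⬝ᵥ b := by
    intro k l M a b
    rw [dotProduct_mulVec, vecMul_transpose]
  have hx : A *ᵥ x + B *ᵥ u = (A - B * K) *ᵥ x + B *ᵥ (K *ᵥ x + u) := by
    rw [sub_mulVec, mulVec_add, ← mulVec_mulVec]; abel
  have h0 := congrArg (fun M => x ⬝ᵥ M *ᵥ x) hLyap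
  simp only [add_assoc _ Q _] at h0
  simp only [add_mulVec _ (Q + Kᵀ * R * K), dotProduct_add, zero_mulVec, dotProduct_zero] at h0
  rw [add_mulVec, dotProduct_add, ← mulVec_mulVec, ← mulVec_mulVec, hT, hS x] at h0
  rw [hS x, hx, mulVec_mulVec _ R, hRK, ← mulVec_mulVec, hT, add_dotProduct]
  rw [hS] at h0
  rw [hS ((A - B * K) *ᵥ x)]
  linarith [hS x ((A - B * K) *ᵥ x)]

/-- **Linear case, forward direction of equation (5.24).** If the symmetric matrix `P`
solves the Lyapunov matrix equation `(A-BK)ᵀP + P(A-BK) + Q + KᵀRK = 0` and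
`K⁺ = R⁻¹BᵀP`, then along every trajectory of `ẋ = Ax + Bu` with continuous control
`u`, the off-policy integral identity (5.24) holds. -/
theorem linear_lyapunov_implies_integral_equation {n m : ℕ}
    (A : Matrix (Fin n) (Fin n) ℝ) (B : Matrix (Fin n) (Fin m) ℝ)
    (Q : Matrix (Fin n) (Fin n) ℝ) (hQsymm : Q.IsSymm)
    (R : Matrix (Fin m) (Fin m) ℝ) (hRsymm : R.IsSymm) (hRpos : R.PosDef)
    (K : Matrix (Fin m) (Fin n) ℝ)
    (P : Matrix (Fin n) (Fin n) ℝ) (hPsymm : P.IsSymm)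
    (hLyap : (A - B * K)ᵀ * P + P * (A - B * K) + Q + Kᵀ * R * K = 0)
    (Kplus : Matrix (Fin m) (Fin n) ℝ) (hKplus : Kplus = R⁻¹ * Bᵀ * P) :
    ∀ I : Set ℝ, I.OrdConnected →
      ∀ (u : ℝ → Fin m → ℝ) (x : ℝ → Fin n → ℝ),
        ContinuousOn u I →
        (∀ t ∈ I, HasDerivWithinAt x (A *ᵥ x t + B *ᵥ u t) I t) →
        ∀ t ∈ I, ∀ Δt ≥ (0:ℝ), t + Δt ∈ I →
          x t ⬝ᵥ P *ᵥ x t - x (t + Δt) ⬝ᵥ P *ᵥ x (t + Δt)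
              + 2 * ∫ τ in t..(t + Δt), (K *ᵥ x τ + u τ) ⬝ᵥ R *ᵥ (Kplus *ᵥ x τ)
            = ∫ τ in t..(t + Δt), x τ ⬝ᵥ (Q + Kᵀ * R * K) *ᵥ x τ := by
  intro I hI u x hu hx t ht Δt hΔ ht'
  have hsub : Icc t (t + Δt) ⊆ I := hI.out ht ht'
  have hle : t ≤ t + Δt := by linarith
  have hV : ∀ s ∈ I, HasDerivWithinAt (fun τ => x τ ⬝ᵥ P *ᵥ x τ)
      (2 * ((K *ᵥ x s + u s) ⬝ᵥ R *ᵥ (Kplus *ᵥ x s))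
        - x s ⬝ᵥ (Q + Kᵀ * R * K) *ᵥ x s) I s := by
    intro s hs
    rw [← lyapunov_pointwise_aux A B Q R hRpos K P hPsymm hLyap Kplus hKplus]
    exact hasDerivWithinAt_dotProduct_aux (hx s hs) (hasDerivWithinAt_mulVec_aux P (hx s hs))
  have hxc : ContinuousOn x (Icc t (t + Δt)) :=
    fun s hs => ((hx s (hsub hs)).continuousWithinAt).mono hsub
  have huc : ContinuousOn u (Icc t (t + Δt)) := hu.mono hsub
  have hmul : ∀ {k l : ℕ} (M : Matrix (Fin k) (Fin l) ℝ) {y : ℝ → Fin l → ℝ},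
      ContinuousOn y (Icc t (t + Δt)) → ContinuousOn (fun s => M *ᵥ y s) (Icc t (t + Δt)) :=
    fun M y hy => (Continuous.matrix_mulVec continuous_const continuous_id).comp_continuousOn hy
  have hdot : ∀ {l : ℕ} {y z : ℝ → Fin l → ℝ},
      ContinuousOn y (Icc t (t + Δt)) → ContinuousOn z (Icc t (t + Δt)) →
      ContinuousOn (fun s => y s ⬝ᵥ z s) (Icc t (t + Δt)) :=
    fun hy hz => (Continuous.dotProduct continuous_fst continuous_snd).comp_continuousOn
      (hy.prodMk hz)
  have hf := (hdot ((hmul K hxc).add huc) (hmul R (hmul Kplus hxc))).intervalIntegrable_of_Icc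
    (μ := MeasureTheory.volume) hle
  have hg := (hdot hxc (hmul (Q + Kᵀ * R * K) hxc)).intervalIntegrable_of_Icc
    (μ := MeasureTheory.volume) hle
  have key := intervalIntegral.integral_eq_sub_of_hasDerivAt_of_le hle (hdot hxc (hmul P hxc))
    (fun s hs => (hV s (hsub (Ioo_subset_Icc_self hs))).hasDerivAt
      (Filter.mem_of_superset (Icc_mem_nhds hs.1 hs.2) hsub)) ((hf.const_mul 2).sub hg)
  have hsplit := intervalIntegral.integral_sub (hf.const_mul 2) hg
  rw [intervalIntegral.integral_const_mul] at hsplit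
  have hall := hsplit.symm.trans key
  simp only [Pi.add_apply] at hall
  linarith
end

section
/- (Linear case, converse direction of equation (5.24).) Let K, K⁺ ∈ ℝ^{m×n} and let P ∈ ℝ^{n×n} be symmetric. Suppose that for every x₀ ∈ ℝⁿ and every u₀ ∈ ℝᵐ there exists a trajectory x : [0,∞) → ℝⁿ with constant control u(t) ≡ u₀ and x(0) = x₀ such that for all 0 ≤ t ≤ t+Δt: x(t)ᵀPx(t) − x(t+Δt)ᵀPx(t+Δt) + 2∫_t^{t+Δt} (Kx(τ) + u₀)ᵀR K⁺ x(τ) dτ = ∫_t^{t+Δt} x(τ)ᵀ(Q + KᵀRK)x(τ) dτ. Then RK⁺ = BᵀP (i.e., K⁺ = R⁻¹BᵀP) and (A − BK)ᵀP + P(A − BK) + Q + KᵀRK = 0. -/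
open Matrix Set

theorem aux_dot_s12 {k : ℕ} {f g : ℝ → Fin k → ℝ} {f' g' : Fin k → ℝ} {s : Set ℝ} {t : ℝ}
    (hf : HasDerivWithinAt f f' s t) (hg : HasDerivWithinAt g g' s t) :
    HasDerivWithinAt (fun τ => f τ ⬝ᵥ g τ) (f' ⬝ᵥ g t + f t ⬝ᵥ g') s t := by
  rw [hasDerivWithinAt_pi] at hf hg
  have := HasDerivWithinAt.fun_sum (u := Finset.univ) (fun i _ => (hf i).mul (hg i))
  simpa [dotProduct, Finset.sum_add_distrib] using this

theorem aux_mulVec_s12 {k l : ℕ} (M : Matrix (Fin l) (Fin k) ℝ) {f : ℝ → Fin k → ℝ} {f' : Fin k → ℝ}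
    {s : Set ℝ} {t : ℝ} (hf : HasDerivWithinAt f f' s t) :
    HasDerivWithinAt (fun τ => M *ᵥ f τ) (M *ᵥ f') s t := by
  have := (LinearMap.toContinuousLinearMap (Matrix.mulVecLin M)).hasFDerivAt.comp_hasDerivWithinAt
    t hf
  simpa [Function.comp_def] using this

theorem aux_int {f : ℝ → ℝ} (hf : ContinuousOn f (Ici 0)) :
    HasDerivWithinAt (fun s => ∫ τ in (0:ℝ)..s, f τ) (f 0) (Ici 0) 0 := by
  have h0 : (0:ℝ) ∈ Ici (0:ℝ) := self_mem_Ici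
  refine intervalIntegral.integral_hasDerivWithinAt_right (t := Ioi 0) (by simp) ?_ ?_
  · exact (hf.mono Ioi_subset_Ici_self).stronglyMeasurableAtFilter_nhdsWithin measurableSet_Ioi 0
  · exact (hf 0 h0).mono Ioi_subset_Ici_self

theorem aux_bilin {k l : ℕ} (M N : Matrix (Fin l) (Fin k) ℝ)
    (h : ∀ u x, u ⬝ᵥ M *ᵥ x = u ⬝ᵥ N *ᵥ x) : M = N := by
  ext i j
  simpa using h (Pi.single i 1) (Pi.single j 1)

theorem aux_quad {k : ℕ} (M : Matrix (Fin k) (Fin k) ℝ) (hM : M.IsSymm)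
    (h : ∀ x, x ⬝ᵥ M *ᵥ x = 0) : M = 0 := by
  ext i j
  have h1 := h (Pi.single i 1)
  have h2 := h (Pi.single j 1)
  have h3 := h (Pi.single i 1 + Pi.single j 1)
  have h4 := hM.apply i j
  simp [mulVec_add] at h1 h2 h3
  simp
  linarith


/-- **Linear case, converse direction of equation (5.24).** If for every initial state
`x₀` and every constant control `u₀` there is a trajectory of `ẋ = Ax + Bu₀` along
which the off-policy integral identity (5.24) holds, then `RK⁺ = BᵀP` and `P` solves
the Lyapunov matrix equation `(A-BK)ᵀP + P(A-BK) + Q + KᵀRK = 0`. -/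
theorem linear_integral_equation_implies_lyapunov {n m : ℕ}
    (A : Matrix (Fin n) (Fin n) ℝ) (B : Matrix (Fin n) (Fin m) ℝ)
    (Q : Matrix (Fin n) (Fin n) ℝ) (hQsymm : Q.IsSymm)
    (R : Matrix (Fin m) (Fin m) ℝ) (hRsymm : R.IsSymm) (hRpos : R.PosDef)
    (K Kplus : Matrix (Fin m) (Fin n) ℝ)
    (P : Matrix (Fin n) (Fin n) ℝ) (hPsymm : P.IsSymm)
    (hex : ∀ (x₀ : Fin n → ℝ) (u₀ : Fin m → ℝ), ∃ x : ℝ → (Fin n → ℝ),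
      x 0 = x₀ ∧
      (∀ t ∈ Ici (0:ℝ), HasDerivWithinAt x (A *ᵥ x t + B *ᵥ u₀) (Ici 0) t) ∧
      (∀ t ≥ (0:ℝ), ∀ Δt ≥ (0:ℝ),
        x t ⬝ᵥ P *ᵥ x t - x (t + Δt) ⬝ᵥ P *ᵥ x (t + Δt)
            + 2 * ∫ τ in t..(t + Δt), (K *ᵥ x τ + u₀) ⬝ᵥ R *ᵥ (Kplus *ᵥ x τ)
          = ∫ τ in t..(t + Δt), x τ ⬝ᵥ (Q + Kᵀ * R * K) *ᵥ x τ)) :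
    R * Kplus = Bᵀ * P ∧
    (A - B * K)ᵀ * P + P * (A - B * K) + Q + Kᵀ * R * K = 0 := by
  have key : ∀ (x : Fin n → ℝ) (u : Fin m → ℝ),
      -((A *ᵥ x + B *ᵥ u) ⬝ᵥ P *ᵥ x + x ⬝ᵥ P *ᵥ (A *ᵥ x + B *ᵥ u))
        + 2 * ((K *ᵥ x + u) ⬝ᵥ R *ᵥ (Kplus *ᵥ x)) = x ⬝ᵥ (Q + Kᵀ * R * K) *ᵥ x := by
    intro x₀ u
    obtain ⟨x, hx0, hd, hI⟩ := hex x₀ u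
    have h0 : (0:ℝ) ∈ Ici (0:ℝ) := self_mem_Ici
    have hc1 : ContinuousOn (fun τ => (K *ᵥ x τ + u) ⬝ᵥ R *ᵥ (Kplus *ᵥ x τ)) (Ici 0) :=
      fun t ht => (aux_dot_s12 ((aux_mulVec_s12 K (hd t ht)).add_const u)
        (aux_mulVec_s12 R (aux_mulVec_s12 Kplus (hd t ht)))).continuousWithinAt
    have hc2 : ContinuousOn (fun τ => x τ ⬝ᵥ (Q + Kᵀ * R * K) *ᵥ x τ) (Ici 0) :=
      fun t ht => (aux_dot_s12 (hd t ht) (aux_mulVec_s12 _ (hd t ht))).continuousWithinAt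
    have d1 := ((aux_dot_s12 (hd 0 h0) (aux_mulVec_s12 P (hd 0 h0))).const_sub (x 0 ⬝ᵥ P *ᵥ x 0)).add
      ((aux_int hc1).const_mul 2)
    have d2 := aux_int hc2
    have heq := fun (s : ℝ) (hs : s ∈ Ici (0:ℝ)) => hI 0 le_rfl s hs
    simp only [zero_add] at heq
    have this := (uniqueDiffOn_Ici (0:ℝ) 0 h0).eq_deriv _ d1
      (d2.congr_of_mem (fun s hs => heq s hs) h0)
    rw [hx0] at this
    exact this
  have h1 : R * Kplus = Bᵀ * P := by
    apply aux_bilin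
    intro u x
    have a := key x u
    have b := key x 0
    have e1 : x ⬝ᵥ P *ᵥ (B *ᵥ u) = u ⬝ᵥ (Bᵀ * P) *ᵥ x := by
      rw [← mulVec_mulVec, dotProduct_mulVec, dotProduct_mulVec, ← mulVec_transpose,
        ← mulVec_transpose, hPsymm.eq, dotProduct_comm]
    have e2 : (B *ᵥ u) ⬝ᵥ P *ᵥ x = u ⬝ᵥ (Bᵀ * P) *ᵥ x := by
      rw [← mulVec_mulVec, dotProduct_mulVec u, vecMul_transpose]
    simp only [mulVec_add, add_dotProduct, dotProduct_add, mulVec_zero, zero_dotProduct,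
      dotProduct_zero, e1, e2] at a b
    rw [← mulVec_mulVec]
    linarith
  refine ⟨h1, ?_⟩
  apply aux_quad
  · have : P = Pᵀ := hPsymm.eq.symm
    simp only [Matrix.IsSymm, transpose_add, transpose_mul, transpose_transpose, hPsymm.eq,
      hQsymm.eq, hRsymm.eq, Matrix.mul_assoc]
    rw [add_comm (P * _)]
  · intro x
    have b := key x 0
    have e0 : (B *ᵥ (K *ᵥ x)) ⬝ᵥ P *ᵥ x = (K *ᵥ x) ⬝ᵥ R *ᵥ (Kplus *ᵥ x) := by
      rw [mulVec_mulVec _ R, h1, ← mulVec_mulVec, dotProduct_mulVec _ Bᵀ, vecMul_transpose]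
    have e1 : x ⬝ᵥ P *ᵥ (B *ᵥ (K *ᵥ x)) = (K *ᵥ x) ⬝ᵥ R *ᵥ (Kplus *ᵥ x) := by
      rw [← e0, dotProduct_mulVec, ← mulVec_transpose, hPsymm.eq, dotProduct_comm]
    have e2 : x ⬝ᵥ ((A - B * K)ᵀ * P) *ᵥ x
        = (A *ᵥ x) ⬝ᵥ P *ᵥ x - (B *ᵥ (K *ᵥ x)) ⬝ᵥ P *ᵥ x := by
      rw [← mulVec_mulVec, dotProduct_mulVec, vecMul_transpose, sub_mulVec, sub_dotProduct,
        mulVec_mulVec]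
    have e3 : x ⬝ᵥ (P * (A - B * K)) *ᵥ x
        = x ⬝ᵥ P *ᵥ (A *ᵥ x) - x ⬝ᵥ P *ᵥ (B *ᵥ (K *ᵥ x)) := by
      rw [← mulVec_mulVec, sub_mulVec, mulVec_sub, dotProduct_sub, mulVec_mulVec _ B]
    simp only [mulVec_zero, add_zero, add_mulVec, dotProduct_add] at b
    simp only [add_mulVec, dotProduct_add, e2, e3, e0, e1]
    linarith
end
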